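/- Let F be a field of characteristic p > 0, let b ∈ F and set E := F(b^{1/p}). Then H_p^{n+1}(E/F) equals the image in H_p^{n+1}(F) of the subgroup db ∧ Ω_F^{n-1} of Ω_F^n, which also equals the image in H_p^{n+1}(F) of the subgroup b·d(Ω_F^{n-1}). -/

import Mathlib

noncomputable section

/-- The full algebra of absolute differential forms of a field `F`:
the exterior algebra of the `F`-module of absolute Kähler differentials `Ω[F⁄ℤ]`. -/
abbrev DF (F : Type*) [Field F] : Type _ :=
  ExteriorAlgebra F (KaehlerDifferential ℤ F)

/-- `Ω_F^n`, the space of differential `n`-forms, as a submodule of `DF F`. -/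
def omegaPow (F : Type*) [Field F] (n : ℕ) : Submodule F (DF F) :=
  LinearMap.range (ExteriorAlgebra.ι F :
    KaehlerDifferential ℤ F →ₗ[F] DF F) ^ n

/-- `Ω_F^{n-1}`, with the convention `Ω_F^{-1} = 0`. -/
def omegaPred (F : Type*) [Field F] : ℕ → Submodule F (DF F)
  | 0 => ⊥
  | n + 1 => omegaPow F n

/-- The exact 1-form `d a` of an element `a ∈ F`. -/
def dForm (F : Type*) [Field F] (a : F) : DF F :=
  ExteriorAlgebra.ι F (KaehlerDifferential.D ℤ F a)

/-- The logarithmic 1-form `da/a` of an element `a ∈ F`. -/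
def dLog (F : Type*) [Field F] (a : F) : DF F :=
  ExteriorAlgebra.ι F (a⁻¹ • KaehlerDifferential.D ℤ F a)

/-- The logarithmic `n`-form `(dx₁/x₁) ∧ … ∧ (dxₙ/xₙ)`. -/
def logForm (F : Type*) [Field F] {n : ℕ} (x : Fin n → F) : DF F :=
  (List.ofFn fun i => dLog F (x i)).prod

/-- The exterior derivative `d` together with the (`p`-basis dependent) additive map `s_p`
on the differential forms of a field `F` of characteristic `p`. -/
structure DiffStr (p : ℕ) (F : Type*) [Field F] where
  d : DF F →+ DF F
  sp : DF F →+ DF F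
  d_grade : ∀ n : ℕ, ∀ ω ∈ omegaPow F n, d ω ∈ omegaPow F (n + 1)
  d_d : ∀ ω : DF F, d (d ω) = 0
  d_one : d 1 = 0
  d_smul : ∀ (a : F) (ω : DF F), d (a • ω) = dForm F a * ω + a • d ω
  sp_grade : ∀ n : ℕ, ∀ ω ∈ omegaPow F n, sp ω ∈ omegaPow F n
  sp_log : ∀ (n : ℕ) (a : F) (x : Fin n → F),
      ∃ η ∈ omegaPred F n, sp (a • logForm F x) = a ^ p • logForm F x + d η

/-- The Artin–Schreier map `℘ = s_p − id` on differential forms. -/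
def asMap {p : ℕ} {F : Type*} [Field F] (S : DiffStr p F) : DF F →+ DF F :=
  S.sp - AddMonoidHom.id (DF F)

/-- The subgroup `℘Ω_F^n + dΩ_F^{n-1}` of `Ω_F^n`; the group `H_p^{n+1}(F)` is the quotient
of `Ω_F^n` by this subgroup. -/
def hRel {p : ℕ} {F : Type*} [Field F] (S : DiffStr p F) (n : ℕ) : AddSubgroup (DF F) :=
  ((omegaPow F n).toAddSubgroup.map (asMap S)) ⊔ ((omegaPred F n).toAddSubgroup.map S.d)

/-- The `t`-th iterate `v ↦ v^{[p^t]}` of the map `s_p`. -/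
def spIter {p : ℕ} {F : Type*} [Field F] (S : DiffStr p F) (t : ℕ) : DF F → DF F :=
  (fun x => S.sp x)^[t]

/-- `ν_n(F) = ker(℘ : Ω_F^n → Ω_F^n/dΩ_F^{n-1})`. -/
def nuSet {p : ℕ} {F : Type*} [Field F] (S : DiffStr p F) (n : ℕ) : Set (DF F) :=
  { η | η ∈ omegaPow F n ∧ ∃ z ∈ omegaPred F n, S.sp η - η = S.d z }

/-- Restriction of differential forms along a field extension `E/F`. -/
structure DiffRes (p : ℕ) (F E : Type*) [Field F] [Field E] [Algebra F E]
    (SF : DiffStr p F) (SE : DiffStr p E) where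
  res : DF F →+ DF E
  res_one : res 1 = 1
  res_mul : ∀ x y : DF F, res (x * y) = res x * res y
  res_smul : ∀ (a : F) (ω : DF F), res (a • ω) = algebraMap F E a • res ω
  res_dForm : ∀ a : F, res (dForm F a) = dForm E (algebraMap F E a)
  res_grade : ∀ n : ℕ, ∀ ω ∈ omegaPow F n, res ω ∈ omegaPow E n
  res_d : ∀ ω : DF F, res (SF.d ω) = SE.d (res ω)


/-! ### Jacobson's formula -/

def jq {L : Type*} [CommRing L] (D : Derivation ℤ L L) (a f : L) : ℕ → ℕ → L
  | 0, 0 => f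
  | 0, _ + 1 => 0
  | n + 1, 0 => D (jq D a f n 0)
  | n + 1, k + 1 => D (jq D a f n (k + 1)) + a * jq D a f n k

theorem jq_zero_right {L : Type*} [CommRing L] (D : Derivation ℤ L L) (a f : L) (n : ℕ) :
    jq D a f n 0 = D^[n] f := by
  induction n with
  | zero => rfl
  | succ n ih => rw [Function.iterate_succ_apply', ← ih]; rfl

theorem jq_gt {L : Type*} [CommRing L] (D : Derivation ℤ L L) (a f : L) (n : ℕ) :
    ∀ k, n < k → jq D a f n k = 0 := by
  induction n with
  | zero => intro k hk; obtain ⟨k, rfl⟩ := Nat.exists_eq_succ_of_ne_zero (by omega : k ≠ 0); rfl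
  | succ n ih =>
    intro k hk
    obtain ⟨k, rfl⟩ := Nat.exists_eq_succ_of_ne_zero (by omega : k ≠ 0)
    simp only [jq]
    rw [ih _ (by omega), ih _ (by omega)]; simp

theorem jq_diag {L : Type*} [CommRing L] (D : Derivation ℤ L L) (a f : L) (n : ℕ) :
    jq D a f n n = a ^ n * f := by
  induction n with
  | zero => simp [jq]
  | succ n ih => simp only [jq]; rw [ih, jq_gt _ _ _ _ _ (by omega)]; simp; ring

theorem jq_sum {L : Type*} [CommRing L] (D : Derivation ℤ L L) (a f : L) (n : ℕ) :
    (fun y => D y + a * y)^[n] f = ∑ k ∈ Finset.range (n + 1), jq D a f n k := by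
  induction n with
  | zero => simp [jq]
  | succ n ih =>
    rw [Function.iterate_succ_apply', ih, Finset.sum_range_succ' _ (n + 1)]
    simp only [jq, Finset.sum_add_distrib, ← Finset.mul_sum]
    rw [Finset.sum_range_succ (fun k => D (jq D a f n (k + 1))), jq_gt D a f n (n+1) (by omega),
      map_sum, Finset.sum_range_succ' _ n]
    simp; ring

theorem jq_key {L : Type*} [CommRing L] (D : Derivation ℤ L L) (a f : L) (n : ℕ) : ∀ k,
    ((k + 1 : ℕ) : L) * jq D a f (n + 1) (k + 1) =
      ∑ j ∈ Finset.range (n + 1), ((n + 1).choose (j + 1) : L) * D^[j] a * jq D a f (n - j) k := by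
  induction n with
  | zero =>
    intro k
    cases k with
    | zero => simp [jq]
    | succ k => simp [jq]
  | succ n ih =>
    intro k
    have h1 : ((k + 1 : ℕ) : L) * jq D a f (n + 1 + 1) (k + 1) =
      D (((k + 1 : ℕ) : L) * jq D a f (n + 1) (k + 1)) +
        a * (((k : ℕ) : L) * jq D a f (n + 1) k) + a * jq D a f (n + 1) k := by
      rw [show jq D a f (n + 1 + 1) (k + 1) = D (jq D a f (n+1) (k + 1)) + a * jq D a f (n+1) k
        from rfl]
      rw [D.leibniz, Derivation.map_natCast]; simp; ring
    have h2 : D (((k + 1 : ℕ) : L) * jq D a f (n + 1) (k + 1)) +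
        a * (((k : ℕ) : L) * jq D a f (n + 1) k) =
        ∑ j ∈ Finset.range (n + 1), (((n + 1).choose (j + 1) : L) * D^[j+1] a * jq D a f (n - j) k
          + ((n + 1).choose (j + 1) : L) * D^[j] a * jq D a f (n + 1 - j) k) := by
      rw [ih k, map_sum]
      cases k with
      | zero =>
        simp only [Nat.cast_zero, zero_mul, mul_zero, add_zero]
        refine Finset.sum_congr rfl fun j hj => ?_
        rw [Finset.mem_range] at hj
        rw [show n + 1 - j = (n - j) + 1 by omega]
        rw [show jq D a f (n - j + 1) 0 = D (jq D a f (n-j) 0) from rfl]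
        rw [D.leibniz, D.leibniz, Derivation.map_natCast, Function.iterate_succ_apply']
        simp; ring
      | succ k =>
        rw [ih k, Finset.mul_sum, ← Finset.sum_add_distrib]
        refine Finset.sum_congr rfl fun j hj => ?_
        rw [Finset.mem_range] at hj
        rw [show n + 1 - j = (n - j) + 1 by omega]
        rw [show jq D a f (n - j + 1) (k+1) = D (jq D a f (n-j) (k+1)) + a * jq D a f (n-j) k
          from rfl]
        rw [D.leibniz, D.leibniz, Derivation.map_natCast, Function.iterate_succ_apply']
        simp; ring
    rw [h1, h2, Finset.sum_add_distrib, Finset.sum_range_succ' _ (n + 1)]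
    simp only [Nat.choose_succ_succ (n + 1), Nat.cast_add, add_mul, Finset.sum_add_distrib]
    rw [Finset.sum_range_succ' (fun j => ((n + 1).choose (j + 1) : L) * D^[j] a * jq D a f (n + 1 - j) k) n]
    rw [Finset.sum_range_succ (fun j => ((n + 1).choose (j + 1 + 1) : L) * D^[j + 1] a * jq D a f (n + 1 - (j + 1)) k) n]
    simp; ring

theorem jacobson {L : Type*} [CommRing L] [IsDomain L] (p : ℕ) (hp : p.Prime) [CharP L p]
    (D : Derivation ℤ L L) (a f : L) :
    (fun y => D y + a * y)^[p] f = D^[p] f + (a ^ p + D^[p-1] a) * f := by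
  obtain ⟨m, rfl⟩ : ∃ m, p = m + 2 := ⟨p - 2, by have := hp.two_le; omega⟩
  have key : ∀ k, ((k + 1 : ℕ) : L) * jq D a f (m + 2) (k + 1) = D^[m+1] a * jq D a f 0 k := by
    intro k
    rw [jq_key, Finset.sum_eq_single (m+1)]
    · simp
    · intro j hj hj'
      rw [Finset.mem_range] at hj
      have : (((m+1+1).choose (j + 1) : ℕ) : L) = 0 := by
        rw [CharP.cast_eq_zero_iff L (m+2)]
        exact hp.dvd_choose_self (by omega) (by omega)
      rw [this]; simp
    · simp
  rw [jq_sum, Finset.sum_range_succ, jq_diag, Finset.sum_range_succ', jq_zero_right,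
    Finset.sum_range_succ']
  rw [Finset.sum_eq_zero]
  · have h0 : jq D a f (m + 2) 1 = D^[m + 1] a * f := by
      simpa [show jq D a f 0 0 = f from rfl] using key 0
    simp only [zero_add, h0, Nat.add_one_sub_one, show m + 2 - 1 = m + 1 by omega]
    ring
  · intro k hk
    rw [Finset.mem_range] at hk
    have := key (k+1)
    simp only [jq, mul_zero, mul_eq_zero] at this
    refine this.resolve_left ?_
    rw [CharP.cast_eq_zero_iff L (m+2)]
    exact Nat.not_dvd_of_pos_of_lt (by omega) (by omega)

/-! ### Commuting logarithmic derivations -/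

structure LogDer (p : ℕ) (L : Type*) [Field L] (ι : Type*) [LinearOrder ι] where
  D : ι → Derivation ℤ L L
  t : ι → L
  t_ne : ∀ i, t i ≠ 0
  Dt : ∀ i j, D i (t j) = if i = j then t j else 0
  comm : ∀ i j a, D i (D j a) = D j (D i a)
  pw : ∀ i a, (D i)^[p] a = D i a
  fin : ∀ a, {i | D i a ≠ 0}.Finite

namespace LogDer

variable {p : ℕ} {L : Type*} [Field L] {ι : Type*} [LinearOrder ι] (Λ : LogDer p L ι)

def pi (i : ι) (a : L) : L := a - (Λ.D i)^[p-1] a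

theorem iter_comm (i j : ι) (m k : ℕ) (a : L) :
    (Λ.D i)^[m] ((Λ.D j)^[k] a) = (Λ.D j)^[k] ((Λ.D i)^[m] a) := by
  have h : Function.Commute (Λ.D i) (Λ.D j) := fun a => Λ.comm i j a
  exact (h.iterate_iterate m k) a

theorem D_pi (hp : p.Prime) (i : ι) (a : L) : Λ.D i (Λ.pi i a) = 0 := by
  unfold pi
  rw [map_sub, ← Function.iterate_succ_apply' (f := Λ.D i), Nat.succ_eq_add_one,
    Nat.sub_add_cancel hp.one_le, Λ.pw, sub_self]

theorem D_iter_pow (hp : p.Prime) (i : ι) (a : L) :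
    (Λ.D i)^[p-1] ((Λ.D i)^[p-1] a) = (Λ.D i)^[p-1] a := by
  obtain ⟨m, rfl⟩ : ∃ m, p = m + 2 := ⟨p - 2, by have := hp.two_le; omega⟩
  rw [← Function.iterate_add_apply, show m + 2 - 1 + (m + 2 - 1) = m + (m + 2) by omega,
    Function.iterate_add_apply, Λ.pw, ← Function.iterate_succ_apply]
  rfl

theorem pi_D (i j : ι) (a : L) : Λ.pi i (Λ.D j a) = Λ.D j (Λ.pi i a) := by
  unfold pi
  rw [map_sub]; congr 1
  exact Λ.iter_comm i j (p-1) 1 a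

theorem pi_D_self (hp : p.Prime) (i : ι) (a : L) : Λ.pi i (Λ.D i a) = 0 := by
  rw [pi_D, D_pi _ hp]

theorem pi_pi (i j : ι) (a : L) : Λ.pi i (Λ.pi j a) = Λ.pi j (Λ.pi i a) := by
  unfold pi
  rw [iterate_map_sub, iterate_map_sub, iter_comm]; ring

theorem pi_sub (i : ι) (a b : L) : Λ.pi i (a - b) = Λ.pi i a - Λ.pi i b := by
  unfold pi
  rw [iterate_map_sub]; ring

theorem pi_add (i : ι) (a b : L) : Λ.pi i (a + b) = Λ.pi i a + Λ.pi i b := by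
  unfold pi
  rw [iterate_map_add]; ring

theorem pi_zero (i : ι) : Λ.pi i 0 = 0 := by
  unfold pi
  rw [iterate_map_zero]; ring

theorem pi_of_D (hp : p.Prime) (i : ι) (a : L) (h : Λ.D i a = 0) : Λ.pi i a = a := by
  unfold pi
  obtain ⟨m, rfl⟩ : ∃ m, p = m + 2 := ⟨p - 2, by have := hp.two_le; omega⟩
  rw [show m + 2 - 1 = m + 1 by omega, Function.iterate_succ_apply, h, iterate_map_zero, sub_zero]

/-- closed + vanishing `pi` implies exact -/
theorem exact_of_pi (hp : p.Prime) (s : Finset ι) : ∀ (w : ι → L), (∀ i, i ∉ s → w i = 0) →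
    (∀ i j, Λ.D i (w j) = Λ.D j (w i)) → (∀ i, Λ.pi i (w i) = 0) → ∃ f, ∀ i, w i = Λ.D i f := by
  induction s using Finset.induction_on with
  | empty => intro w h _ _; exact ⟨0, fun i => by simp [h i]⟩
  | insert x s hx ih =>
    intro w h hc hpi
    have hw : ∀ i, Λ.pi x (w i) = w i - Λ.D i ((Λ.D x)^[p-2] (w x)) := by
      intro i
      have h1 : Λ.D i ((Λ.D x)^[p-2] (w x)) = (Λ.D x)^[p-2] (Λ.D i (w x)) :=
        Λ.iter_comm i x 1 (p-2) _
      rw [h1, hc, ← Function.iterate_succ_apply, pi]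
      rw [show (p-2).succ = p - 1 by have := hp.two_le; omega]
    obtain ⟨f, hf⟩ := ih (fun i => Λ.pi x (w i)) (by
      intro i hi
      by_cases hix : i = x
      · subst hix; exact hpi i
      · rw [h i (by simp [hi, hix]), pi_zero]) (by
      intro i j
      rw [← pi_D, ← pi_D, hc]) (by
      intro i
      rw [pi_pi, hpi, pi_zero])
    refine ⟨f + (Λ.D x)^[p-2] (w x), fun i => ?_⟩
    rw [map_add, ← hf, hw]; ring

theorem exists_eig (hp : p.Prime) [CharP L p] (V : AddSubgroup L) (T : L →+ L)
    (hV : ∀ v ∈ V, T v ∈ V) (hT : ∀ v, T^[p] v = T v) (v : L) (hv : v ∈ V) (hv0 : v ≠ 0) :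
    ∃ w ∈ V, w ≠ 0 ∧ ∃ k : ℕ, T w = (k : L) * w := by
  have := Fact.mk hp
  let _ := ZMod.algebra L p
  let T' : Module.End (ZMod p) L := T.toZModLinearMap p
  have hT' : ∀ v, T' v = T v := fun _ => rfl
  have key : ∀ s : Finset (ZMod p), ∀ v ∈ V, v ≠ 0 →
      Polynomial.aeval T' (∏ j ∈ s, (Polynomial.X - Polynomial.C j)) v = 0 →
      ∃ w ∈ V, w ≠ 0 ∧ ∃ k : ℕ, T w = (k : L) * w := by
    intro s
    induction s using Finset.induction_on with
    | empty => intro v _ h0 h; simp at h; exact absurd h h0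
    | insert j s hj ih =>
      intro v hv hv0 h
      rw [Finset.prod_insert hj, mul_comm, map_mul, Module.End.mul_apply] at h
      have e1 : Polynomial.aeval T' (Polynomial.X - Polynomial.C j) v
          = T v - (j.val : L) * v := by
        rw [map_sub, Polynomial.aeval_X, Polynomial.aeval_C, LinearMap.sub_apply, hT',
          Module.algebraMap_end_apply, Algebra.smul_def]
        congr 2
        conv_lhs => rw [← ZMod.natCast_zmod_val j]
        exact map_natCast _ _
      by_cases h0 : T v - (j.val : L) * v = 0
      · exact ⟨v, hv, hv0, j.val, sub_eq_zero.1 h0⟩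
      · rw [e1] at h
        refine ih _ ?_ h0 h
        refine V.sub_mem (hV v hv) ?_
        rw [← nsmul_eq_mul]; exact V.nsmul_mem hv _
  refine key Finset.univ v hv hv0 ?_
  have : (∏ j : ZMod p, (Polynomial.X - Polynomial.C j)) = (Polynomial.X ^ p - Polynomial.X) := by
    have h1 : (Polynomial.X ^ p - Polynomial.X : Polynomial (ZMod p)).roots = Finset.univ.val := by
      have := FiniteField.roots_X_pow_card_sub_X (ZMod p)
      rwa [ZMod.card] at this
    have h2 := FiniteField.X_pow_card_sub_X_natDegree_eq (ZMod p) hp.one_lt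
    have h3 := Polynomial.prod_multiset_X_sub_C_of_monic_of_roots_card_eq
      (p := (Polynomial.X ^ p - Polynomial.X : Polynomial (ZMod p))) (by
        refine Polynomial.monic_X_pow_sub ?_
        rw [Polynomial.degree_X]; exact_mod_cast hp.one_lt) (by
        rw [h1, h2, Finset.card_val, Finset.card_univ, ZMod.card])
    rw [h1] at h3
    exact h3
  rw [this, map_sub, map_pow, Polynomial.aeval_X, LinearMap.sub_apply, Module.End.pow_apply]
  have h3 : (T' : L → L)^[p] v = T^[p] v := rfl
  rw [h3, hT, hT', sub_self]

theorem exists_h (hp : p.Prime) [CharP L p] (x : ι) (c : L) (hc : ∀ i, x < i → Λ.D i c = 0)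
    (hpi : Λ.pi x c = c ^ p) :
    ∃ h : L, h ≠ 0 ∧ Λ.D x h = c * h ∧ ∀ i, x < i → Λ.D i h = 0 := by
  have := Fact.mk hp
  let V : AddSubgroup L :=
    { carrier := {y | ∀ i, x < i → Λ.D i y = 0}
      zero_mem' := fun i _ => map_zero _
      add_mem' := fun {a b} ha hb i hi => by rw [map_add, ha i hi, hb i hi, add_zero]
      neg_mem' := fun {a} ha i hi => by rw [map_neg, ha i hi, neg_zero] }
  let T : L →+ L := (Λ.D x : L →+ L) + AddMonoidHom.mulLeft (-c)
  have hTv : ∀ v, T v = Λ.D x v + (-c) * v := fun _ => rfl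
  obtain ⟨w, hwV, hw0, k, hk⟩ := exists_eig (p := p) hp V T (by
      intro v hv i hi
      have hv' : ∀ i, x < i → Λ.D i v = 0 := hv
      rw [hTv, map_add, (Λ.D i).leibniz, map_neg, hc i hi, Λ.comm, hv' i hi]; simp) (by
      intro v
      have h1 : (T : L → L) = fun y => Λ.D x y + (-c) * y := rfl
      rw [h1, jacobson p hp, Λ.pw]
      have h2 : (Λ.D x)^[p-1] (-c) = - (c - c^p) := by
        rw [iterate_map_neg, ← hpi, pi]; ring
      rw [h2, neg_pow, neg_one_pow_char]; ring) 1
      (fun i _ => by simp) one_ne_zero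
  obtain ⟨m, hm⟩ : ∃ m : ℕ, (m : L) = - (k : L) := by
    refine ⟨(-(k : ZMod p)).val, ?_⟩
    let _ := ZMod.algebra L p
    have : algebraMap (ZMod p) L (-(k : ZMod p)) = - (k : L) := by rw [map_neg, map_natCast]
    rw [← this]
    conv_rhs => rw [← ZMod.natCast_zmod_val (-(k : ZMod p))]
    exact (map_natCast _ _).symm
  rw [hTv] at hk
  have hDt : ∀ i, Λ.D i (Λ.t x ^ m) = if i = x then (m : L) * Λ.t x ^ m else 0 := by
    intro i
    rw [Derivation.leibniz_pow, Λ.Dt]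
    split_ifs with hix
    · rcases m with _ | m
      · simp
      · simp [pow_succ]; try ring
    · simp
  refine ⟨Λ.t x ^ m * w, mul_ne_zero (pow_ne_zero _ (Λ.t_ne x)) hw0, ?_, ?_⟩
  · rw [(Λ.D x).leibniz, hDt, if_pos rfl, hm]
    simp only [smul_eq_mul]
    have : Λ.D x w = k * w + c * w := by linear_combination hk
    rw [this]; ring
  · intro i hi
    rw [(Λ.D i).leibniz, hDt, if_neg (ne_of_gt hi), hwV i hi]; simp

theorem dlog_pow (hp : p.Prime) [CharP L p] (i : ι) (h : L) (h0 : h ≠ 0) :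
    Λ.pi i (Λ.D i h / h) = (Λ.D i h / h) ^ p := by
  have h1 := jacobson p hp (Λ.D i) (Λ.D i h / h) 1
  have h2 : ∀ m, (fun y => Λ.D i y + (Λ.D i h / h) * y)^[m] 1 = (Λ.D i)^[m] h / h := by
    intro m
    induction m with
    | zero => simp [h0]
    | succ m ih =>
      rw [Function.iterate_succ_apply', Function.iterate_succ_apply', ih, Derivation.leibniz_div]
      simp only [smul_eq_mul]
      field_simp
      ring
  rw [h2, Λ.pw, Λ.pw] at h1
  simp at h1
  unfold pi
  linear_combination h1

theorem dlog_closed (h : L) (i j : ι) :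
    Λ.D i (Λ.D j h / h) = Λ.D j (Λ.D i h / h) := by
  rw [Derivation.leibniz_div, Derivation.leibniz_div, Λ.comm]
  simp only [smul_eq_mul]; ring

end LogDer


/-! ### Extension to a separable extension and the twisted logarithmic form -/

theorem exists_derivation_ext {E L : Type*} [Field E] [Field L] [Algebra E L]
    [Algebra.IsSeparable E L] (δ : Derivation ℤ E E) :
    ∃ δ' : Derivation ℤ L L, ∀ a, δ' (algebraMap E L a) = algebraMap E L (δ a) := by
  have : Algebra.FormallyEtale E L := Algebra.FormallyEtale.of_isSeparable E L
  let δ1 : Derivation ℤ E L := (Algebra.linearMap E L).compDer δ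
  let φ : TensorProduct E L (KaehlerDifferential ℤ E) →ₗ[L] L :=
    LinearMap.liftBaseChange L δ1.liftKaehlerDifferential
  let ψ : KaehlerDifferential ℤ L →ₗ[L] L :=
    φ ∘ₗ (KaehlerDifferential.tensorKaehlerEquivOfFormallyEtale ℤ E L).symm.toLinearMap
  refine ⟨ψ.compDer (KaehlerDifferential.D ℤ L), fun a => ?_⟩
  have h := KaehlerDifferential.tensorKaehlerEquivOfFormallyEtale_symm_D_algebraMap ℤ E L a
  have h1 : (ψ.compDer (KaehlerDifferential.D ℤ L)) (algebraMap E L a) =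
    φ ((KaehlerDifferential.tensorKaehlerEquivOfFormallyEtale ℤ E L).symm
      (KaehlerDifferential.D ℤ L (algebraMap E L a))) := rfl
  rw [h1, h]
  simp only [φ, LinearMap.liftBaseChange_tmul, one_smul, Derivation.liftKaehlerDifferential_comp_D]
  rfl

theorem der_pow_p {p : ℕ} {L : Type*} [Field L] [CharP L p] (D : Derivation ℤ L L) (a : L) :
    D (a ^ p) = 0 := by
  rw [Derivation.leibniz_pow, ← Nat.cast_smul_eq_nsmul L, CharP.cast_eq_zero, zero_smul]

theorem trace_pow_p {p : ℕ} (hp : p.Prime) {E L : Type*} [Field E] [Field L] [Algebra E L]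
    [CharP E p] [FiniteDimensional E L] [Algebra.IsSeparable E L] (y : L) :
    Algebra.trace E L (y ^ p) = (Algebra.trace E L y) ^ p := by
  have := Fact.mk hp
  have : CharP (AlgebraicClosure E) p := charP_of_injective_algebraMap (algebraMap E _).injective p
  apply (algebraMap E (AlgebraicClosure E)).injective
  rw [map_pow (algebraMap E (AlgebraicClosure E)), trace_eq_sum_embeddings (AlgebraicClosure E),
    trace_eq_sum_embeddings (AlgebraicClosure E), sum_pow_char]
  simp

namespace LogDer

variable {p : ℕ} {E : Type*} [Field E] {ι : Type*} [LinearOrder ι] (Λ : LogDer p E ι)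

theorem exists_twist (hp : p.Prime) [CharP E p] (x : ι) (e : E) (e0 : e ≠ 0)
    (he : ∀ i, x < i → Λ.D i e = 0) (hpe : Λ.pi x e⁻¹ = 1) :
    ∃ (θ : ι → E) (f : E), {i | θ i ≠ 0}.Finite ∧ θ x = e⁻¹ ∧ (∀ i, x < i → θ i = 0) ∧
      (∀ i j, Λ.D i (θ j) = Λ.D j (θ i)) ∧ ∀ i, e ^ p * θ i ^ p - θ i = Λ.D i f := by
  have := Fact.mk hp
  have p2 := hp.two_le
  obtain ⟨c0, hc0⟩ := IsAlgClosed.exists_pow_nat_eq (algebraMap E (AlgebraicClosure E) e)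
    (n := p - 1) (by omega)
  have hIntegral : IsIntegral E c0 := Algebra.IsIntegral.isIntegral c0
  have hpol : Polynomial.aeval c0 (Polynomial.X ^ (p-1) - Polynomial.C e) = 0 := by simp [hc0]
  have hp1 : ((p - 1 : ℕ) : E) ≠ 0 := by
    rw [Ne, CharP.cast_eq_zero_iff E p]
    exact Nat.not_dvd_of_pos_of_lt (by omega) (by omega)
  have hdvd := minpoly.dvd E c0 hpol
  have hsep : IsSeparable E c0 :=
    (Polynomial.separable_X_pow_sub_C e hp1 e0).of_dvd hdvd
  have hdeg : (minpoly E c0).natDegree ≤ p - 1 := by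
    have := Polynomial.natDegree_le_of_dvd hdvd
      (Polynomial.X_pow_sub_C_ne_zero (by omega) e)
    rwa [Polynomial.natDegree_X_pow_sub_C] at this
  have hsepL : Algebra.IsSeparable E (IntermediateField.adjoin E {c0}) :=
    (IntermediateField.isSeparable_adjoin_simple_iff_isSeparable _ _).2 hsep
  have hfinL : FiniteDimensional E (IntermediateField.adjoin E {c0}) :=
    IntermediateField.adjoin.finiteDimensional hIntegral
  have hr : Module.finrank E (IntermediateField.adjoin E {c0}) ≤ p - 1 := by
    rw [IntermediateField.adjoin.finrank hIntegral]; exact hdeg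
  have hgen : Algebra.adjoin E {IntermediateField.AdjoinSimple.gen E c0} = ⊤ := by
    have := (IntermediateField.adjoin.powerBasis hIntegral).adjoin_gen_eq_top
    rwa [IntermediateField.adjoin.powerBasis_gen] at this
  have hcc : (IntermediateField.AdjoinSimple.gen E c0) ^ (p - 1) =
      algebraMap E (IntermediateField.adjoin E {c0}) e := by
    apply Subtype.ext
    simpa using hc0
  generalize IntermediateField.AdjoinSimple.gen E c0 = c at hgen hcc
  generalize (IntermediateField.adjoin E {c0}) = L at c hgen hcc hr hsepL hfinL
  have hcharL : CharP L p := charP_of_injective_algebraMap (algebraMap E L).injective p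
  have c_ne : c ≠ 0 := by
    rintro rfl
    rw [zero_pow (by omega)] at hcc
    exact e0 ((algebraMap E L).injective (by rw [← hcc, map_zero]))
  set γ := c ^ p with hγ
  have γ_ne : γ ≠ 0 := pow_ne_zero _ c_ne
  have hγc : γ = algebraMap E L e * c := by
    rw [← hcc, hγ, ← pow_succ]; congr 1; omega
  have hcγ : c = algebraMap E L e⁻¹ * γ := by
    rw [hγc, ← mul_assoc, ← map_mul, inv_mul_cancel₀ e0, map_one, one_mul]
  have hspan : ∀ P : L → Prop, (∀ a k, P (algebraMap E L a * γ ^ k)) →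
      (∀ y z, P y → P z → P (y + z)) → ∀ y, P y := by
    intro P h1 h2 y
    have hy : y ∈ Algebra.adjoin E {c} := by rw [hgen]; trivial
    rw [Algebra.adjoin_singleton_eq_range_aeval] at hy
    obtain ⟨q, rfl⟩ := hy
    change P (Polynomial.aeval c q)
    induction q using Polynomial.induction_on' with
    | add q r hq hr => rw [map_add]; exact h2 _ _ hq hr
    | monomial k a =>
      rw [Polynomial.aeval_monomial, hcγ, mul_pow, ← mul_assoc, ← map_pow, ← map_mul]
      exact h1 _ _
  choose D' hD' using fun i => exists_derivation_ext (L := L) (Λ.D i)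
  have hDγ : ∀ i k a, D' i (algebraMap E L a * γ ^ k) = algebraMap E L (Λ.D i a) * γ ^ k := by
    intro i k a
    rw [(D' i).leibniz, hD', hγ, ← pow_mul, mul_comm p k, pow_mul, der_pow_p]
    simp [mul_comm]
  have hDγi : ∀ i k m a, (D' i)^[m] (algebraMap E L a * γ ^ k) =
      algebraMap E L ((Λ.D i)^[m] a) * γ ^ k := by
    intro i k m
    induction m with
    | zero => intro a; rfl
    | succ m ih => intro a; rw [Function.iterate_succ_apply, hDγ, ih]; rfl
  let Λ' : LogDer p L ι :=
    { D := D'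
      t := fun i => algebraMap E L (Λ.t i)
      t_ne := fun i => by simpa using Λ.t_ne i
      Dt := fun i j => by rw [hD', Λ.Dt]; split_ifs <;> simp
      comm := fun i j => hspan _ (fun a k => by rw [hDγ, hDγ, hDγ, hDγ, Λ.comm])
        (fun y z hy hz => by rw [map_add, map_add, map_add, map_add, hy, hz])
      pw := fun i => hspan _ (fun a k => by rw [hDγi, hDγ, Λ.pw])
        (fun y z hy hz => by rw [iterate_map_add, map_add, hy, hz])
      fin := hspan _ (fun a k => (Λ.fin a).subset fun i hi => by
          rw [Set.mem_ofPred_eq, hDγ] at hi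
          intro h
          rw [h] at hi; simp at hi)
        (fun y z hy hz => (hy.union hz).subset fun i hi => by
          by_contra h
          simp only [Set.mem_union, Set.mem_ofPred_eq, not_or, not_not] at h
          exact hi (by rw [map_add, h.1, h.2, add_zero])) }
  have hΛD : Λ'.D = D' := rfl
  -- trace
  have htrD : ∀ i y, Algebra.trace E L (D' i y) = Λ.D i (Algebra.trace E L y) := by
    intro i
    refine hspan _ (fun a k => ?_) (fun y z hy hz => by rw [map_add, map_add, map_add, map_add, hy, hz])
    rw [hDγ, ← Algebra.smul_def, ← Algebra.smul_def, map_smul, map_smul, smul_eq_mul, smul_eq_mul,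
      (Λ.D i).leibniz, hγ, ← pow_mul, mul_comm p k, pow_mul, trace_pow_p hp, der_pow_p]
    simp [mul_comm]
  have htrDi : ∀ i m y, Algebra.trace E L ((D' i)^[m] y) = (Λ.D i)^[m] (Algebra.trace E L y) := by
    intro i m
    induction m with
    | zero => intro y; rfl
    | succ m ih => intro y; rw [Function.iterate_succ_apply, ih, htrD]; rfl
  obtain ⟨h, h0, hx, hgt⟩ := Λ'.exists_h hp x c (by
      intro i hi
      have := hDγ i 1 e⁻¹
      rw [pow_one, ← hcγ] at this
      rw [hΛD, this, Derivation.leibniz_inv, he i hi]; simp) (by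
      have := hDγi x 1 (p-1) e⁻¹
      rw [pow_one, ← hcγ] at this
      unfold pi at hpe ⊢
      rw [hΛD, this]
      conv_lhs => rw [hcγ]
      rw [← sub_mul, ← map_sub, hpe, map_one, one_mul])
  set r : E := (Module.finrank E L : E) with hrdef
  have r0 : r ≠ 0 := by
    rw [hrdef, Ne, CharP.cast_eq_zero_iff E p]
    exact Nat.not_dvd_of_pos_of_lt Module.finrank_pos (by omega)
  have rp : (r⁻¹) ^ p = r⁻¹ := by
    rw [inv_pow, hrdef]
    congr 1
    rw [← frobenius_def, map_natCast]
  let C : ι → L := fun i => D' i h / h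
  have hCx : C x = c := by
    change D' x h / h = c
    rw [show D' x h = c * h from hx, mul_div_cancel_right₀ _ h0]
  have hCgt : ∀ i, x < i → C i = 0 := fun i hi => by
    change D' i h / h = 0
    rw [show D' i h = 0 from hgt i hi, zero_div]
  have hCp : ∀ i, C i ^ p = C i - (D' i)^[p-1] (C i) := fun i => (Λ'.dlog_pow hp i h h0).symm
  have hCc : ∀ i j, D' i (C j) = D' j (C i) := Λ'.dlog_closed h
  -- `γ⁻¹` is a constant
  have hDγinv : ∀ i y, D' i (γ⁻¹ * y) = γ⁻¹ * D' i y := by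
    intro i y
    have : D' i γ⁻¹ = 0 := by rw [Derivation.leibniz_inv, hγ, der_pow_p, smul_zero]
    rw [(D' i).leibniz, this]; simp
  have hDγinvi : ∀ i m y, (D' i)^[m] (γ⁻¹ * y) = γ⁻¹ * (D' i)^[m] y := by
    intro i m
    induction m with
    | zero => intro y; rfl
    | succ m ih => intro y; rw [Function.iterate_succ_apply, hDγinv, ih]; rfl
  let θ : ι → E := fun i => r⁻¹ * Algebra.trace E L (γ⁻¹ * C i)
  have Dr : ∀ i y, Λ.D i (r⁻¹ * y) = r⁻¹ * Λ.D i y := by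
    intro i y
    rw [(Λ.D i).leibniz, ← rp, der_pow_p]; simp
  have Dri : ∀ i m y, (Λ.D i)^[m] (r⁻¹ * y) = r⁻¹ * (Λ.D i)^[m] y := by
    intro i m
    induction m with
    | zero => intro y; rfl
    | succ m ih => intro y; rw [Function.iterate_succ_apply, Dr, ih]; rfl
  have hθc : ∀ i j, Λ.D i (θ j) = Λ.D j (θ i) := by
    intro i j
    simp only [θ]
    rw [Dr, Dr, ← htrD, ← htrD, hDγinv, hDγinv, hCc]
  have hθp : ∀ i, e ^ p * θ i ^ p - θ i = - (Λ.D i)^[p-1] (θ i) := by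
    intro i
    simp only [θ]
    rw [Dri, ← htrDi, hDγinvi, mul_pow, rp, ← trace_pow_p hp, mul_pow]
    have h1 : e ^ p * (r⁻¹ * Algebra.trace E L (γ⁻¹ ^ p * C i ^ p)) =
        r⁻¹ * Algebra.trace E L (γ⁻¹ * C i ^ p) := by
      rw [mul_left_comm, ← smul_eq_mul (e ^ p), ← map_smul, Algebra.smul_def, ← mul_assoc]
      congr 4
      rw [map_pow, ← hcc, ← pow_mul, mul_comm (p-1) p, pow_mul, ← hγ]
      rw [inv_pow]
      field_simp
      rw [← pow_succ, show p - 1 + 1 = p by omega]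
    rw [h1, hCp, mul_sub, map_sub]; ring
  have hθfin : {i | θ i ≠ 0}.Finite := (Λ'.fin h).subset fun i hi hi' => by
    apply hi
    have : C i = 0 := by
      change D' i h / h = 0
      rw [show D' i h = 0 from hi', zero_div]
    simp [θ, this]
  obtain ⟨f, hf⟩ := Λ.exact_of_pi hp hθfin.toFinset (fun i => e ^ p * θ i ^ p - θ i)
    (fun i hi => by
      have : θ i = 0 := by simpa using hi
      simp [this, hp.ne_zero])
    (fun i j => by
      rw [map_sub, map_sub, ← mul_pow, ← mul_pow, der_pow_p, der_pow_p, hθc])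
    (fun i => by
      simp only [hθp]
      unfold pi
      rw [iterate_map_neg, Λ.D_iter_pow hp]; ring)
  refine ⟨θ, f, hθfin, ?_, ?_, hθc, hf⟩
  · simp only [θ, hCx]
    have : γ⁻¹ * c = algebraMap E L e⁻¹ := by
      conv_lhs => rw [hcγ]
      field_simp
    rw [this, Algebra.trace_algebraMap, nsmul_eq_mul, ← mul_assoc, inv_mul_cancel₀ r0, one_mul]
  · intro i hi
    simp [θ, hCgt i hi]

end LogDer


/-! ### Frames: coordinates on differential forms -/

theorem dForm_sq {F : Type*} [Field F] (a : F) : dForm F a * dForm F a = 0 :=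
  ExteriorAlgebra.ι_sq_zero _

theorem dForm_add {F : Type*} [Field F] (a b : F) : dForm F (a + b) = dForm F a + dForm F b := by
  unfold dForm; rw [map_add, map_add]

theorem dForm_mul {F : Type*} [Field F] (a b : F) :
    dForm F (a * b) = a • dForm F b + b • dForm F a := by
  unfold dForm; rw [Derivation.leibniz, map_add, map_smul, map_smul]

theorem dLog_eq {F : Type*} [Field F] (a : F) : dLog F a = a⁻¹ • dForm F a := by
  unfold dLog dForm; rw [map_smul]

theorem dForm_pow_p {p : ℕ} {F : Type*} [Field F] [CharP F p] (a : F) : dForm F (a ^ p) = 0 := by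
  unfold dForm
  rw [Derivation.leibniz_pow, ← Nat.cast_smul_eq_nsmul F, CharP.cast_eq_zero, zero_smul, map_zero]

namespace DiffStr

variable {p : ℕ} {F : Type*} [Field F] (S : DiffStr p F)

theorem d_dForm_mul (a : F) (q : DF F) : S.d (dForm F a * q) = - (dForm F a * S.d q) := by
  have h := S.d_d (a • q)
  rw [S.d_smul, map_add, S.d_smul, S.d_d, smul_zero, add_zero] at h
  exact eq_neg_of_add_eq_zero_left h

theorem d_dLog_mul (a : F) (q : DF F) : S.d (dLog F a * q) = - (dLog F a * S.d q) := by
  rw [dLog_eq, smul_mul_assoc, S.d_smul, d_dForm_mul, ← mul_assoc]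
  have : dForm F a⁻¹ * dForm F a = 0 := by
    unfold dForm
    rw [Derivation.leibniz_inv, map_smul, smul_mul_assoc, ExteriorAlgebra.ι_sq_zero, smul_zero]
  rw [this]; simp

theorem d_logForm {n : ℕ} (x : Fin n → F) : S.d (logForm F x) = 0 := by
  unfold logForm
  generalize hl : (List.ofFn fun i => dLog F (x i)) = l
  have hl' : ∀ w ∈ l, ∃ a, w = dLog F a := by
    intro w hw
    rw [← hl, List.mem_ofFn] at hw
    obtain ⟨i, rfl⟩ := hw
    exact ⟨_, rfl⟩
  clear hl
  induction l with
  | nil => simpa using S.d_one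
  | cons w l ih =>
    obtain ⟨a, rfl⟩ := hl' w (by simp)
    rw [List.prod_cons, d_dLog_mul, ih (fun w hw => hl' w (by simp [hw])), mul_zero, neg_zero]

end DiffStr

structure Frame (p : ℕ) (E : Type*) [Field E] (ι : Type*) [LinearOrder ι] extends
    LogDer p E ι where
  bas : Module.Basis ι E (KaehlerDifferential ℤ E)
  bas_eq : ∀ i, bas i = (t i)⁻¹ • KaehlerDifferential.D ℤ E (t i)
  D_eq : ∀ i a, D i a = bas.repr (KaehlerDifferential.D ℤ E a) i

namespace Frame

variable {p : ℕ} {E : Type*} [Field E] {ι : Type*} [LinearOrder ι] (Φ : Frame p E ι)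

def X : Module.Basis (Finset ι) E (DF E) := Φ.bas.ExteriorAlgebra

def co (w : DF E) (s : Finset ι) : E := Φ.X.repr w s

def ell (i : ι) : DF E := ExteriorAlgebra.ι E (Φ.bas i)

theorem ell_eq (i : ι) : Φ.ell i = dLog E (Φ.t i) := by
  unfold ell dLog; rw [Φ.bas_eq]

theorem ext {v w : DF E} (h : ∀ s, Φ.co v s = Φ.co w s) : v = w :=
  Φ.X.repr.injective (Finsupp.ext h)

theorem co_add (v w : DF E) (s) : Φ.co (v + w) s = Φ.co v s + Φ.co w s := by simp [co]
theorem co_sub (v w : DF E) (s) : Φ.co (v - w) s = Φ.co v s - Φ.co w s := by simp [co]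
theorem co_neg (v : DF E) (s) : Φ.co (-v) s = - Φ.co v s := by simp [co]
theorem co_zero (s) : Φ.co 0 s = 0 := by simp [co]
theorem co_smul (a : E) (v : DF E) (s) : Φ.co (a • v) s = a * Φ.co v s := by simp [co]
theorem co_zsmul (a : ℤ) (v : DF E) (s) : Φ.co (a • v) s = a • Φ.co v s := by
  simp only [co, map_zsmul, Finsupp.smul_apply]
theorem co_X (s r) : Φ.co (Φ.X s) r = if s = r then 1 else 0 := by
  simp [co, Finsupp.single_apply]

theorem ind {P : DF E → Prop} (h0 : P 0) (hadd : ∀ v w, P v → P w → P (v + w))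
    (hX : ∀ (a : E) (s : Finset ι), P (a • Φ.X s)) (w : DF E) : P w := by
  rw [← Φ.X.repr.symm_apply_apply w]
  induction Φ.X.repr w using Finsupp.induction_linear with
  | zero => simpa using h0
  | add f g hf hg => rw [map_add]; exact hadd _ _ hf hg
  | single s a => rw [Module.Basis.repr_symm_single]; exact hX a s

theorem X_eq_logForm (s : Finset ι) {n : ℕ} (h : s.card = n) :
    Φ.X s = logForm E (fun k => Φ.t (s.orderEmbOfFin h k)) := by
  unfold X
  rw [ExteriorAlgebra.basis_apply_ofCard _ h]
  unfold ExteriorAlgebra.ιMulti_family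
  rw [ExteriorAlgebra.ιMulti_apply]
  unfold logForm
  congr 2
  funext k
  exact Φ.ell_eq _

theorem X_singleton (i : ι) : Φ.X {i} = Φ.ell i := by
  rw [Φ.X_eq_logForm {i} (Finset.card_singleton i), ell_eq]
  simp [logForm]

theorem X_empty : Φ.X ∅ = 1 := by
  rw [Φ.X_eq_logForm ∅ Finset.card_empty]
  simp [logForm]

theorem ell_mul_X_of_mem {i : ι} {s : Finset ι} (h : i ∈ s) : Φ.ell i * Φ.X s = 0 := by
  rw [← X_singleton]
  have := ExteriorAlgebra.basis_mul_of_not_disjoint (b := Φ.bas)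
    (Set.powersetCard.ofCard (Finset.card_singleton i)) (Set.powersetCard.ofCard (s := s) rfl)
    (by simpa using h)
  exact this

theorem exists_sg (i : ι) (s : Finset ι) : ∃ ε : ℤ, (ε = 1 ∨ ε = -1) ∧
    (i ∉ s → Φ.ell i * Φ.X s = ε • Φ.X (insert i s)) := by
  by_cases h : i ∈ s
  · exact ⟨1, Or.inl rfl, fun h' => absurd h h'⟩
  have hd : Disjoint (Set.powersetCard.ofCard (Finset.card_singleton i)).val
    (Set.powersetCard.ofCard (s := s) rfl).val := by simpa using h
  have := ExteriorAlgebra.basis_mul_of_disjoint (b := Φ.bas)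
    (Set.powersetCard.ofCard (Finset.card_singleton i)) (Set.powersetCard.ofCard (s := s) rfl) hd
  refine ⟨((Set.powersetCard.permOfDisjoint hd).sign : ℤˣ), ?_, fun _ => ?_⟩
  · rcases Int.units_eq_one_or ((Set.powersetCard.permOfDisjoint hd).sign) with h | h <;>
      simp [h]
  · rw [← X_singleton]
    refine Eq.trans this ?_
    rw [Units.smul_def]
    congr 2
    rw [Finset.insert_eq]
    simp [Finset.disjUnion_eq_union]

def sg (i : ι) (s : Finset ι) : ℤ := (Φ.exists_sg i s).choose

theorem sg_cases (i : ι) (s : Finset ι) : Φ.sg i s = 1 ∨ Φ.sg i s = -1 :=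
  (Φ.exists_sg i s).choose_spec.1

theorem sg_sq (i : ι) (s : Finset ι) (a : E) : Φ.sg i s • Φ.sg i s • a = a := by
  rcases Φ.sg_cases i s with h | h <;> simp [h]

theorem sg_pow (hp : p.Prime) [CharP E p] (i : ι) (s : Finset ι) (a : E) :
    (Φ.sg i s • a) ^ p = Φ.sg i s • a ^ p := by
  have := Fact.mk hp
  rcases Φ.sg_cases i s with h | h
  · simp [h]
  · simp only [h, neg_smul, one_smul]
    rw [neg_pow, neg_one_pow_char]; ring

theorem ell_mul_X {i : ι} {s : Finset ι} (h : i ∉ s) :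
    Φ.ell i * Φ.X s = Φ.sg i s • Φ.X (insert i s) :=
  (Φ.exists_sg i s).choose_spec.2 h

theorem co_ell_mul (i : ι) (w : DF E) (r : Finset ι) :
    Φ.co (Φ.ell i * w) r = if i ∈ r then Φ.sg i (r.erase i) • Φ.co w (r.erase i) else 0 := by
  induction w using Φ.ind with
  | h0 => simp [co_zero]
  | hadd v w hv hw => rw [mul_add, co_add, co_add, hv, hw]; split_ifs <;> simp
  | hX a s =>
    rw [mul_smul_comm, co_smul, co_smul]
    by_cases his : i ∈ s
    · rw [ell_mul_X_of_mem _ his, co_zero, co_X]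
      have : s ≠ r.erase i := by rintro rfl; simp at his
      simp [this]
    · rw [ell_mul_X _ his, co_zsmul, co_X, co_X]
      by_cases hir : i ∈ r
      · rw [if_pos hir]
        by_cases hs : s = r.erase i
        · subst hs
          rw [Finset.insert_erase hir, if_pos rfl, if_pos rfl, mul_smul_comm]
        · rw [if_neg, if_neg hs]
          · simp
          · rintro rfl; exact hs (Finset.erase_insert his).symm
      · rw [if_neg hir, if_neg]
        · simp
        · rintro rfl; simp at hir

theorem co_iota_mul (m : KaehlerDifferential ℤ E) (w : DF E) (r : Finset ι) :
    Φ.co (ExteriorAlgebra.ι E m * w) r =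
      ∑ i ∈ r, Φ.sg i (r.erase i) • (Φ.bas.repr m i * Φ.co w (r.erase i)) := by
  rw [← Φ.bas.repr.symm_apply_apply m]
  induction Φ.bas.repr m using Finsupp.induction_linear with
  | zero => simp [co_zero]
  | add f g hf hg =>
    rw [map_add, map_add, add_mul, co_add, hf, hg, ← Finset.sum_add_distrib]
    refine Finset.sum_congr rfl fun i _ => ?_
    simp [add_mul]
  | single j a =>
    rw [Module.Basis.repr_symm_single, map_smul, smul_mul_assoc, co_smul]
    have := Φ.co_ell_mul j w r
    unfold ell at this
    rw [this]
    simp only [map_smul, Module.Basis.repr_self, Finsupp.smul_apply, Finsupp.single_apply]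
    by_cases hj : j ∈ r
    · rw [if_pos hj, Finset.sum_eq_single j]
      · simp; ring
      · intro i _ hij
        simp [Ne.symm hij]
      · simp [hj]
    · rw [if_neg hj, Finset.sum_eq_zero]
      · simp
      · intro i hi
        have : j ≠ i := by rintro rfl; exact hj hi
        simp [this]

theorem d_X (S : DiffStr p E) (s : Finset ι) : S.d (Φ.X s) = 0 := by
  rw [Φ.X_eq_logForm s rfl, S.d_logForm]

theorem co_d (S : DiffStr p E) (w : DF E) (r : Finset ι) :
    Φ.co (S.d w) r = ∑ i ∈ r, Φ.sg i (r.erase i) • Φ.D i (Φ.co w (r.erase i)) := by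
  induction w using Φ.ind with
  | h0 => simp [co_zero]
  | hadd v w hv hw =>
    rw [map_add, co_add, hv, hw, ← Finset.sum_add_distrib]
    refine Finset.sum_congr rfl fun i _ => ?_
    rw [co_add, map_add, smul_add]
  | hX a s =>
    rw [S.d_smul, d_X, smul_zero, add_zero, dForm, co_iota_mul]
    refine Finset.sum_congr rfl fun i _ => ?_
    rw [co_smul, co_X, ← Φ.D_eq]
    split_ifs <;> simp

def frob (hp : p.Prime) (w : DF E) : DF E :=
  Φ.X.repr.symm ((Φ.X.repr w).mapRange (fun a => a ^ p) (zero_pow hp.ne_zero))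

theorem co_frob (hp : p.Prime) (w : DF E) (s : Finset ι) : Φ.co (Φ.frob hp w) s = Φ.co w s ^ p := by
  simp [co, frob]


theorem frob_add [CharP E p] (hp : p.Prime) (v w : DF E) : Φ.frob hp (v + w) = Φ.frob hp v + Φ.frob hp w := by
  have := Fact.mk hp
  refine Φ.ext fun s => ?_
  rw [co_add, co_frob, co_frob, co_frob, co_add, add_pow_char]

theorem frob_sub [CharP E p] (hp : p.Prime) (v w : DF E) : Φ.frob hp (v - w) = Φ.frob hp v - Φ.frob hp w := by
  have := Fact.mk hp
  refine Φ.ext fun s => ?_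
  rw [co_sub, co_frob, co_frob, co_frob, co_sub, sub_pow_char]

theorem frob_smul (hp : p.Prime) (a : E) (w : DF E) : Φ.frob hp (a • w) = a ^ p • Φ.frob hp w := by
  refine Φ.ext fun s => ?_
  rw [co_smul, co_frob, co_frob, co_smul, mul_pow]

theorem frob_iota_mul [CharP E p] (hp : p.Prime) (m m' : KaehlerDifferential ℤ E) (w : DF E)
    (h : ∀ i, Φ.bas.repr m' i = Φ.bas.repr m i ^ p) :
    Φ.frob hp (ExteriorAlgebra.ι E m * w) = ExteriorAlgebra.ι E m' * Φ.frob hp w := by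
  have := Fact.mk hp
  refine Φ.ext fun s => ?_
  rw [co_frob, co_iota_mul, co_iota_mul, sum_pow_char]
  refine Finset.sum_congr rfl fun i _ => ?_
  rw [co_frob, h, sg_pow _ hp, mul_pow]


theorem d_iota_mul (Φ : Frame p E ι) (S : DiffStr p E) (m : KaehlerDifferential ℤ E) (q : DF E) :
    S.d (ExteriorAlgebra.ι E m * q) =
      S.d (ExteriorAlgebra.ι E m) * q - ExteriorAlgebra.ι E m * S.d q := by
  rw [← Φ.bas.repr.symm_apply_apply m]
  induction Φ.bas.repr m using Finsupp.induction_linear with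
  | zero => simp
  | add f g hf hg =>
    rw [map_add, map_add, add_mul, map_add, map_add, hf, hg]; noncomm_ring
  | single j a =>
    rw [Module.Basis.repr_symm_single, map_smul, smul_mul_assoc, S.d_smul, S.d_smul]
    have h1 := Φ.ell_eq j
    unfold ell at h1
    rw [h1, S.d_dLog_mul]
    have h2 := S.d_dLog_mul (Φ.t j) 1
    rw [S.d_one, mul_zero, mul_one, neg_zero] at h2
    rw [h2]
    simp [mul_assoc, sub_eq_add_neg]

theorem d_iota_closed (S : DiffStr p E) (m : KaehlerDifferential ℤ E)
    (h : ∀ i j, Φ.D i (Φ.bas.repr m j) = Φ.D j (Φ.bas.repr m i)) :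
    S.d (ExteriorAlgebra.ι E m) = 0 := by
  have hell : ∀ j, S.d (Φ.ell j) = 0 := fun j => by rw [← X_singleton, d_X]
  have e1 : ∀ m, ExteriorAlgebra.ι E m = ∑ i ∈ (Φ.bas.repr m).support, Φ.bas.repr m i • Φ.ell i := by
    intro m
    conv_lhs => rw [← Φ.bas.linearCombination_repr m]
    rw [Finsupp.linearCombination_apply, Finsupp.sum, map_sum]
    refine Finset.sum_congr rfl fun i _ => ?_
    rw [map_smul]; rfl
  have e1' : ∀ m (K : Finset ι), (Φ.bas.repr m).support ⊆ K →
      ExteriorAlgebra.ι E m = ∑ i ∈ K, Φ.bas.repr m i • Φ.ell i := by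
    intro m K hK
    rw [e1]
    refine Finset.sum_subset hK fun i _ hi => ?_
    rw [Finsupp.notMem_support_iff.1 hi, zero_smul]
  let K : Finset ι := (Φ.bas.repr m).support ∪
    (Φ.bas.repr m).support.biUnion fun i =>
      (Φ.bas.repr (KaehlerDifferential.D ℤ E (Φ.bas.repr m i))).support
  rw [e1' m K (Finset.subset_union_left), map_sum]
  have e2 : ∀ i ∈ K, S.d (Φ.bas.repr m i • Φ.ell i) =
      ∑ j ∈ K, Φ.D j (Φ.bas.repr m i) • (Φ.ell j * Φ.ell i) := by
    intro i _
    rw [S.d_smul, hell, smul_zero, add_zero, dForm, e1' _ K, Finset.sum_mul]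
    · refine Finset.sum_congr rfl fun j _ => ?_
      rw [Φ.D_eq, smul_mul_assoc]
    · by_cases hi : i ∈ (Φ.bas.repr m).support
      · refine Finset.Subset.trans ?_ Finset.subset_union_right
        exact Finset.subset_biUnion_of_mem
          (fun i => (Φ.bas.repr (KaehlerDifferential.D ℤ E (Φ.bas.repr m i))).support) hi
      · rw [Finsupp.notMem_support_iff.1 hi]; simp
  rw [Finset.sum_congr rfl e2, ← Finset.sum_product']
  have hsq : ∀ i, Φ.ell i * Φ.ell i = 0 := fun i => ExteriorAlgebra.ι_sq_zero _
  refine Finset.sum_involution (fun x _ => (x.2, x.1)) ?_ ?_ ?_ ?_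
  · rintro ⟨i, j⟩ _
    dsimp only
    rw [h i j, ← smul_add]
    have := ExteriorAlgebra.ι_add_mul_swap (R := E) (Φ.bas j) (Φ.bas i)
    change Φ.ell j * Φ.ell i + Φ.ell i * Φ.ell j = 0 at this
    rw [this, smul_zero]
  · rintro ⟨i, j⟩ _ hne heq
    simp only [Prod.mk.injEq] at heq
    apply hne
    dsimp only
    rw [heq.1, hsq, smul_zero]
  · rintro ⟨i, j⟩ hx
    simp only [Finset.mem_product] at hx ⊢
    exact ⟨hx.2, hx.1⟩
  · rintro ⟨i, j⟩ _; rfl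

theorem dForm_repr (a : E) (i : ι) :
    Φ.bas.repr (KaehlerDifferential.D ℤ E a) i = Φ.D i a := (Φ.D_eq i a).symm

end Frame


/-! ### The main claim -/

namespace LogDer

variable {p : ℕ} {L : Type*} [Field L] {ι : Type*} [LinearOrder ι] (Λ : LogDer p L ι)

theorem pi_mul_const (i : ι) (c a : L) (hc : Λ.D i c = 0) : Λ.pi i (c * a) = c * Λ.pi i a := by
  have h : ∀ m, (Λ.D i)^[m] (c * a) = c * (Λ.D i)^[m] a := by
    intro m
    induction m with
    | zero => rfl
    | succ m ih =>
      rw [Function.iterate_succ_apply', ih, Function.iterate_succ_apply', Derivation.leibniz, hc]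
      simp
  unfold pi
  rw [h]; ring

theorem pi_sum (i : ι) {α : Type*} (s : Finset α) (f : α → L) :
    Λ.pi i (∑ j ∈ s, f j) = ∑ j ∈ s, Λ.pi i (f j) := by
  classical
  induction s using Finset.induction_on with
  | empty => simpa using Λ.pi_zero i
  | insert x s hx ih => rw [Finset.sum_insert hx, Finset.sum_insert hx, pi_add, ih]

theorem pi_neg (i : ι) (a : L) : Λ.pi i (-a) = - Λ.pi i a := by
  have := Λ.pi_sub i 0 a
  rw [pi_zero, zero_sub, zero_sub] at this
  exact this

theorem D_inv (i : ι) (c : L) (hc : Λ.D i c = 0) : Λ.D i c⁻¹ = 0 := by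
  rw [Derivation.leibniz_inv, hc, smul_zero]

/-- Admissibility. -/
def Adm (σ : Finset ι) (G : L) : Prop :=
  ∀ i, i ∉ σ → ∃ y : ι → L, Λ.D i G = ∑ j ∈ σ with i < j, Λ.D j (y j)

end LogDer

/-- Strict colex order on finite sets. -/
def clt {ι : Type*} [LinearOrder ι] (s t : Finset ι) : Prop := toColex s < toColex t

theorem clt_iff {ι : Type*} [LinearOrder ι] {s t : Finset ι} :
    clt s t ↔ ∃ a ∈ t, a ∉ s ∧ ∀ b ∈ s, b ∉ t → b < a :=
  Finset.Colex.toColex_lt_toColex_iff_exists_forall_lt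

namespace Frame

variable {p : ℕ} {E : Type*} [Field E] {ι : Type*} [LinearOrder ι] (Φ : Frame p E ι)

theorem frob_neg [CharP E p] (hp : p.Prime) (w : DF E) : Φ.frob hp (-w) = - Φ.frob hp w := by
  have h0 : Φ.frob hp 0 = 0 := by
    refine Φ.ext fun s => ?_
    rw [co_frob, co_zero, zero_pow hp.ne_zero]
  have := Φ.frob_sub hp 0 w
  rw [h0, zero_sub, zero_sub] at this
  exact this

theorem frob_sg [CharP E p] (hp : p.Prime) (i : ι) (s : Finset ι) (w : DF E) :
    Φ.frob hp (Φ.sg i s • w) = Φ.sg i s • Φ.frob hp w := by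
  rcases Φ.sg_cases i s with h | h
  · simp [h]
  · rw [h, neg_smul, one_smul, neg_smul, one_smul, frob_neg]

theorem claim [CharP E p] (hp : p.Prime) (S : DiffStr p E) (κ : E) (κ0 : κ ≠ 0)
    (hκ : ∀ i, Φ.D i κ = 0) (σ : Finset ι) : ∀ G : E, Φ.Adm σ G →
    (∃ y : ι → E, G - κ = ∑ j ∈ σ, Φ.D j (y j)) →
    G ≠ 0 ∧ ∃ Z q : DF E, S.d Z = 0 ∧ Φ.co Z σ = G / κ ∧ (∀ τ, clt σ τ → Φ.co Z τ = 0) ∧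
      (κ / G) ^ p • Φ.frob hp Z - Z = S.d q := by
  induction σ using Finset.induction_on_max with
  | empty =>
    rintro G - ⟨y, hy⟩
    rw [Finset.sum_empty, sub_eq_zero] at hy
    subst hy
    refine ⟨κ0, Φ.X ∅, 0, Φ.d_X S _, ?_, ?_, ?_⟩
    · rw [co_X, if_pos rfl, div_self κ0]
    · intro τ hτ
      rw [co_X, if_neg]
      rintro rfl
      exact lt_irrefl _ hτ
    · rw [div_self κ0, one_pow, one_smul, map_zero, sub_eq_zero]
      refine Φ.ext fun s => ?_
      rw [co_frob, co_X]
      split_ifs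
      · simp
      · exact zero_pow hp.ne_zero
  | insert x σ hx ih =>
    rintro G hA ⟨y, hy⟩
    have hxσ : x ∉ σ := fun h => lt_irrefl _ (hx x h)
    obtain ⟨G'0, Z, q, hZ, hco, hτ, hq⟩ := ih (Φ.pi x G) (by
        intro i hi
        by_cases hix : i = x
        · refine ⟨0, ?_⟩
          rw [hix, Φ.D_pi hp]
          simp
        · obtain ⟨y, hy⟩ := hA i (by simp [hix, hi])
          refine ⟨fun j => Φ.pi x (y j), ?_⟩
          rw [← Φ.pi_D, hy, Φ.pi_sum, Finset.filter_insert]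
          split_ifs with hlt
          · rw [Finset.sum_insert (by simp [hxσ]), Φ.pi_D_self hp, zero_add]
            exact Finset.sum_congr rfl fun j _ => Φ.pi_D _ _ _
          · exact Finset.sum_congr rfl fun j _ => Φ.pi_D _ _ _) (by
        refine ⟨fun j => Φ.pi x (y j), ?_⟩
        have := congrArg (Φ.pi x) hy
        rw [Φ.pi_sub, Φ.pi_of_D hp x κ (hκ x), Φ.pi_sum, Finset.sum_insert hxσ,
          Φ.pi_D_self hp, zero_add] at this
        rw [this]
        exact Finset.sum_congr rfl fun j _ => Φ.pi_D _ _ _)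
    set G' := Φ.pi x G with hG'
    have G0 : G ≠ 0 := by
      intro h
      apply G'0
      rw [hG', h, Φ.pi_zero]
    have hDG : ∀ i, x < i → Φ.D i G = 0 := by
      intro i hi
      obtain ⟨y, hy⟩ := hA i (by
        rw [Finset.mem_insert, not_or]
        exact ⟨ne_of_gt hi, fun h => lt_asymm hi (hx i h)⟩)
      rw [hy, Finset.sum_eq_zero]
      intro j hj
      rw [Finset.mem_filter, Finset.mem_insert] at hj
      exfalso
      rcases hj with ⟨rfl | h, h2⟩
      · exact lt_asymm hi h2
      · exact lt_asymm hi (h2.trans (hx j h))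
    have hDG' : ∀ i, x < i → Φ.D i G' = 0 := by
      intro i hi
      rw [hG', ← Φ.pi_D, hDG i hi, Φ.pi_zero]
    obtain ⟨θ, f, hfin, hθx, hθ0, hθc, hθf⟩ := Φ.exists_twist hp x (G' / G) (div_ne_zero G'0 G0)
      (by
        intro i hi
        rw [Derivation.leibniz_div, hDG i hi, hDG' i hi]; simp)
      (by
        rw [inv_div, div_eq_inv_mul, Φ.pi_mul_const _ _ _ (Φ.D_inv x G' (Φ.D_pi hp x G)), ← hG',
          inv_mul_cancel₀ G'0])
    let m : KaehlerDifferential ℤ E := Φ.bas.repr.symm (Finsupp.ofSupportFinite θ hfin)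
    have hm : ∀ i, Φ.bas.repr m i = θ i := fun i => by
      simp only [m, LinearEquiv.apply_symm_apply]; rfl
    let m' : KaehlerDifferential ℤ E :=
      Φ.bas.repr.symm ((Φ.bas.repr m).mapRange (fun a => a ^ p) (zero_pow hp.ne_zero))
    have hm' : ∀ i, Φ.bas.repr m' i = Φ.bas.repr m i ^ p := fun i => by
      simp only [m', LinearEquiv.apply_symm_apply, Finsupp.mapRange_apply]
    have hmd : S.d (ExteriorAlgebra.ι E m) = 0 :=
      Φ.d_iota_closed S m fun i j => by rw [hm, hm, hθc]
    have hem : (G' / G) ^ p • ExteriorAlgebra.ι E m' = ExteriorAlgebra.ι E m + dForm E f := by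
      unfold dForm
      rw [← map_smul, ← map_add]
      congr 1
      refine Φ.bas.repr.injective (Finsupp.ext fun i => ?_)
      rw [map_smul, map_add, Finsupp.smul_apply, Finsupp.add_apply, Φ.dForm_repr, ← hθf, hm', hm,
        smul_eq_mul]
      ring
    have hdm : ∀ w, S.d (ExteriorAlgebra.ι E m * w) = - (ExteriorAlgebra.ι E m * S.d w) := by
      intro w
      rw [Φ.d_iota_mul, hmd, zero_mul, zero_sub]
    refine ⟨G0, Φ.sg x σ • (ExteriorAlgebra.ι E m * Z),
      Φ.sg x σ • (-(ExteriorAlgebra.ι E m * q) + f • Z + f • S.d q), ?_, ?_, ?_, ?_⟩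
    · rw [map_zsmul, hdm, hZ, mul_zero, neg_zero, smul_zero]
    · rw [co_zsmul, co_iota_mul, Finset.sum_insert hxσ, Finset.erase_insert hxσ,
        Finset.sum_eq_zero, add_zero, sg_sq, hm, hco, hθx]
      · field_simp
      · intro i hi
        have hix : x ≠ i := (hx i hi).ne'
        rw [hτ, mul_zero, smul_zero]
        rw [clt_iff]
        refine ⟨x, by simp [hix], hxσ, fun b hb _ => hx b hb⟩
    · intro τ hlt
      rw [co_zsmul, co_iota_mul, Finset.sum_eq_zero, smul_zero]
      intro i hi
      rcases lt_or_ge x i with h | h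
      · rw [hm, hθ0 i h, zero_mul, smul_zero]
      rw [hτ, mul_zero, smul_zero]
      rw [clt_iff] at hlt ⊢
      obtain ⟨a, haτ, haσ, hab⟩ := hlt
      rw [Finset.mem_insert, not_or] at haσ
      rcases lt_or_gt_of_ne haσ.1 with hax | hxa
      · have hxτ : x ∈ τ := by
          by_contra hn
          exact lt_asymm hax (hab x (by simp) hn)
        rcases eq_or_lt_of_le h with rfl | hix
        · refine ⟨a, by simp [haτ, haσ.1], haσ.2, fun b hb hb' => hab b (by simp [hb]) ?_⟩
          intro hbτ
          exact hb' (by simp [hbτ, (hx b hb).ne])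
        · exact ⟨x, by simp [hxτ, hix.ne'], hxσ, fun b hb _ => hx b hb⟩
      · exact ⟨a, by simp [haτ, (h.trans_lt hxa).ne'], haσ.2, fun b hb _ => (hx b hb).trans hxa⟩
    · have hcoef : (κ / G) ^ p = (G' / G) ^ p * (κ / G') ^ p := by
        rw [← mul_pow]; congr 1; field_simp
      rw [frob_sg, Φ.frob_iota_mul hp m m' Z hm', smul_comm, hcoef, ← smul_sub, map_zsmul]
      congr 1
      rw [← smul_mul_smul_comm, hem, eq_add_of_sub_eq hq, map_add, map_add, map_neg, hdm, neg_neg,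
        S.d_smul, hZ, S.d_smul, S.d_d]
      simp only [smul_zero, add_zero]
      noncomm_ring

end Frame


/-! ### Removing the top variable -/

theorem clt_wf (ι : Type*) [LinearOrder ι] [WellFoundedLT ι] :
    WellFounded (clt : Finset ι → Finset ι → Prop) := by
  classical
  have h := Finsupp.Lex.wellFounded' (α := ι) (N := ℕ) (r := fun a b => b < a)
    (s := (· < ·)) (fun n => Nat.not_lt_zero n) wellFounded_lt wellFounded_lt
  refine Subrelation.wf ?_ (InvImage.wf
    (fun s : Finset ι => Finsupp.indicator s (fun _ _ => (1 : ℕ))) h)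
  intro s t hst
  rw [clt, Finset.Colex.toColex_lt_toColex_iff_exists_forall_lt] at hst
  obtain ⟨a, hat, has, hab⟩ := hst
  -- choose the largest difference
  have hne : (s \ t ∪ t \ s).Nonempty := ⟨a, by simp [hat, has]⟩
  obtain ⟨c, hc, hcmax⟩ := Finset.exists_max_image (s \ t ∪ t \ s) id hne
  have hac : a ≤ c := hcmax a (by simp [hat, has])
  have hct : c ∈ t ∧ c ∉ s := by
    simp only [Finset.mem_union, Finset.mem_sdiff] at hc
    rcases hc with h | h
    · exact absurd (hab c h.1 h.2) (not_lt.2 hac)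
    · exact h
  change Finsupp.Lex _ _ _ _
  rw [Finsupp.lex_def]
  refine ⟨c, fun j hj => ?_, ?_⟩
  · have : j ∈ s ↔ j ∈ t := by
      by_contra hn
      have : j ∈ s \ t ∪ t \ s := by
        simp only [Finset.mem_union, Finset.mem_sdiff]
        tauto
      exact absurd (hcmax j this) (not_le.2 hj)
    simp [Finsupp.indicator_apply, this]
  · simp [Finsupp.indicator_apply, hct]

namespace Frame

variable {p : ℕ} {E : Type*} [Field E] {ι : Type*} [LinearOrder ι] (Φ : Frame p E ι)

theorem d_frob [CharP E p] (hp : p.Prime) (S : DiffStr p E) (u : DF E) :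
    S.d (Φ.frob hp u) = 0 := by
  refine Φ.ext fun r => ?_
  rw [co_d, co_zero, Finset.sum_eq_zero]
  intro i _
  rw [co_frob, der_pow_p, smul_zero]

theorem step [CharP E p] (hp : p.Prime) (S : DiffStr p E) (x : ι) (hx : ∀ i, i ≤ x)
    (W : DF E) (hW : ∀ s, x ∈ s → Φ.co W s = 0) (u v : DF E)
    (h : W = Φ.frob hp u - u + S.d v) (hex : ∃ s, x ∈ s ∧ Φ.co u s ≠ 0) :
    ∃ (σ : Finset ι) (u' v' : DF E), x ∈ σ ∧ Φ.co u σ ≠ 0 ∧ W = Φ.frob hp u' - u' + S.d v' ∧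
      ∀ s, x ∈ s → Φ.co u' s ≠ 0 → clt s σ := by
  classical
  obtain ⟨σ, hσ, hmax⟩ := Finset.exists_max_image
    ((Φ.X.repr u).support.filter (fun s => x ∈ s)) (fun s => toColex s) (by
      obtain ⟨s, hs, hs'⟩ := hex
      exact ⟨s, by simpa [hs, co] using hs'⟩)
  rw [Finset.mem_filter, Finsupp.mem_support_iff] at hσ
  obtain ⟨hσ0, hxσ⟩ := hσ
  change Φ.co u σ ≠ 0 at hσ0
  have hmax' : ∀ s, x ∈ s → clt σ s → Φ.co u s = 0 := by
    intro s hs hlt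
    by_contra hn
    exact absurd (hmax s (by simpa [hs, co] using hn)) (not_le.2 hlt)
  set g := Φ.co u σ with hg
  have hw : ∀ s, x ∈ s → Φ.co (S.d v) s = Φ.co u s - Φ.co u s ^ p := by
    intro s hs
    have := hW s hs
    rw [h, co_add, co_sub, co_frob] at this
    linear_combination this
  have hκ : ∀ i, Φ.D i (g ^ p) = 0 := fun i => der_pow_p _ _
  obtain ⟨-, Z, q, hZ, hco, hτ, hq⟩ := Φ.claim hp S (g ^ p) (pow_ne_zero _ hσ0) hκ σ g (by
      intro i hi
      have h1 : Φ.co (S.d (S.d v)) (insert i σ) = 0 := by rw [S.d_d, co_zero]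
      rw [co_d, Finset.sum_insert hi, Finset.erase_insert hi, hw σ hxσ, map_sub, ← hg, hκ,
        sub_zero] at h1
      have h2 : ∀ j ∈ σ, ¬ i < j → Φ.co (S.d v) ((insert i σ).erase j) = 0 := by
        intro j hj hij
        have hne : i ≠ j := by rintro rfl; exact hi hj
        have hji : j < i := lt_of_le_of_ne (not_lt.1 hij) hne.symm
        have hxj : x ≠ j := fun h => absurd (hx i) (by rw [h]; exact not_le.2 hji)
        have hxm : x ∈ (insert i σ).erase j := by simp [hxj, hxσ]
        rw [hw _ hxm, hmax' _ hxm, zero_pow hp.ne_zero, sub_zero]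
        rw [clt_iff]
        refine ⟨i, by simp [hne], hi, fun b hb hb' => ?_⟩
        have : b = j := by
          by_contra hbj
          exact hb' (by simp [hbj, hb])
        rw [this]; exact hji
      refine ⟨fun j => - (Φ.sg i σ • Φ.sg j ((insert i σ).erase j) •
        Φ.co (S.d v) ((insert i σ).erase j)), ?_⟩
      rw [Finset.sum_filter]
      have h3 : Φ.D i g = - (Φ.sg i σ • ∑ j ∈ σ, Φ.sg j ((insert i σ).erase j) •
          Φ.D j (Φ.co (S.d v) ((insert i σ).erase j))) := by
        have := congrArg (fun a => Φ.sg i σ • a) h1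
        simp only [smul_add, smul_zero, sg_sq] at this
        exact eq_neg_of_add_eq_zero_left this
      rw [h3, Finset.smul_sum, ← Finset.sum_neg_distrib]
      refine Finset.sum_congr rfl fun j hj => ?_
      split_ifs with hij
      · rw [map_neg, map_zsmul, map_zsmul]
      · rw [h2 j hj hij]; simp) (by
      refine ⟨fun j => Φ.sg j (σ.erase j) • Φ.co v (σ.erase j), ?_⟩
      rw [hg, ← hw σ hxσ, co_d]
      refine Finset.sum_congr rfl fun j hj => ?_
      rw [map_zsmul])
  refine ⟨σ, u - g ^ p • Z, v + g ^ p • q, hxσ, hσ0, ?_, ?_⟩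
  · have e1 : S.d (g ^ p • q) = Φ.frob hp (g ^ p • Z) - g ^ p • Z := by
      have hd : dForm E (g ^ p) = 0 := dForm_pow_p g
      rw [S.d_smul, hd, zero_mul, zero_add, ← hq, frob_smul, smul_sub, smul_smul]
      congr 2
      rw [← mul_pow, mul_div_cancel₀ _ hσ0]
    rw [map_add, e1, frob_sub, h]
    abel
  · intro s hs hne
    by_contra hn
    apply hne
    rw [co_sub, co_smul]
    rcases eq_or_lt_of_le (not_lt.1 hn) with he | hlt
    · have : σ = s := toColex_inj.1 he
      subst this
      rw [hco]
      field_simp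
      rw [← hg]; ring
    · rw [hmax' s hs hlt, hτ s hlt]; ring

theorem descend [CharP E p] (hp : p.Prime) [WellFoundedLT ι] (S : DiffStr p E) (x : ι)
    (hx : ∀ i, i ≤ x) (W : DF E) (hW : ∀ s, x ∈ s → Φ.co W s = 0) (u v : DF E)
    (h : W = Φ.frob hp u - u + S.d v) :
    ∃ u' v' : DF E, W = Φ.frob hp u' - u' + S.d v' ∧ ∀ s, x ∈ s → Φ.co u' s = 0 := by
  have key : ∀ σ : Finset ι, ∀ u v : DF E, W = Φ.frob hp u - u + S.d v →
      (∀ s, x ∈ s → Φ.co u s ≠ 0 → clt s σ) →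
      ∃ u' v' : DF E, W = Φ.frob hp u' - u' + S.d v' ∧ ∀ s, x ∈ s → Φ.co u' s = 0 := by
    intro σ
    induction σ using (clt_wf ι).induction with
    | _ σ ih =>
    intro u v h hb
    by_cases hex : ∃ s, x ∈ s ∧ Φ.co u s ≠ 0
    · obtain ⟨σ', u', v', h1, h2, h3, h4⟩ := Φ.step hp S x hx W hW u v h hex
      exact ih σ' (hb σ' h1 h2) u' v' h3 h4
    · push Not at hex
      exact ⟨u, v, h, hex⟩
  by_cases hex : ∃ s, x ∈ s ∧ Φ.co u s ≠ 0
  · obtain ⟨σ', u', v', h1, h2, h3, h4⟩ := Φ.step hp S x hx W hW u v h hex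
    exact key σ' u' v' h3 h4
  · push Not at hex
    exact ⟨u, v, h, hex⟩

theorem theoremA [CharP E p] (hp : p.Prime) [WellFoundedLT ι] (S : DiffStr p E) (x : ι)
    (hx : ∀ i, i ≤ x) (W : DF E) (hW : ∀ s, x ∈ s → Φ.co W s = 0)
    (hW' : ∀ s, Φ.D x (Φ.co W s) = 0) (u v : DF E)
    (h : W = Φ.frob hp u - u + S.d v) :
    ∃ u' v' : DF E, W = Φ.frob hp u' - u' + S.d v' ∧ (∀ s, x ∈ s → Φ.co u' s = 0) ∧
      (∀ s, Φ.D x (Φ.co u' s) = 0) ∧ (∀ s, x ∈ s → Φ.co v' s = 0) ∧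
      (∀ s, Φ.D x (Φ.co v' s) = 0) := by
  obtain ⟨u, v, h, hu⟩ := Φ.descend hp S x hx W hW u v h
  have hdtop : ∀ w : DF E, (∀ s, x ∈ s → Φ.co w s = 0) → ∀ r, x ∈ r →
      Φ.co (S.d w) r = Φ.sg x (r.erase x) • Φ.D x (Φ.co w (r.erase x)) := by
    intro w hw r hr
    rw [co_d, Finset.sum_eq_single x]
    · intro i _ hix
      rw [hw _ (by simp [hr, Ne.symm hix])]; simp
    · intro hn; exact absurd hr hn
  have hu' : ∀ s, Φ.D x (Φ.co u s) = 0 := by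
    intro s
    by_cases hs : x ∈ s
    · rw [hu s hs, map_zero]
    have h1 : S.d W = - S.d u := by
      rw [h, map_add, map_sub, d_frob, S.d_d]; simp
    have h2 := congrArg (fun w => Φ.co w (insert x s)) h1
    simp only [co_neg] at h2
    rw [hdtop W hW _ (by simp), hdtop u hu _ (by simp), Finset.erase_insert hs, hW', smul_zero] at h2
    have h3 := congrArg (fun a => Φ.sg x s • a) h2
    simp only [smul_neg, sg_sq, smul_zero] at h3
    exact neg_eq_zero.1 h3.symm
  let v' : DF E := Φ.X.repr.symm (Finsupp.onFinset (Φ.X.repr v).support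
    (fun s => if x ∈ s then 0 else Φ.pi x (Φ.X.repr v s)) (by
      intro s hs
      rw [Finsupp.mem_support_iff]
      intro h0
      apply hs
      rw [h0, Φ.pi_zero, ite_self]))
  have hv' : ∀ s, Φ.co v' s = if x ∈ s then 0 else Φ.pi x (Φ.co v s) := by
    intro s
    unfold co
    simp only [v', LinearEquiv.apply_symm_apply, Finsupp.onFinset_apply]
  have hv0 : ∀ s, x ∈ s → Φ.co v' s = 0 := fun s hs => by rw [hv', if_pos hs]
  have hv1 : ∀ s, Φ.D x (Φ.co v' s) = 0 := by
    intro s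
    rw [hv']
    split_ifs
    · simp
    · rw [Φ.D_pi hp]
  refine ⟨u, v', Φ.ext fun r => ?_, hu, hu', hv0, hv1⟩
  rw [co_add, co_sub, co_frob]
  by_cases hr : x ∈ r
  · rw [hdtop v' hv0 r hr, hv1, hW r hr, hu r hr, zero_pow hp.ne_zero]; simp
  · have h1 := congrArg (fun w => Φ.pi x (Φ.co w r)) h
    simp only [co_add, co_sub, co_frob, Φ.pi_add, Φ.pi_sub] at h1
    rw [Φ.pi_of_D hp x _ (hW' r), Φ.pi_of_D hp x _ (hu' r),
      Φ.pi_of_D hp x _ (der_pow_p _ _)] at h1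
    rw [h1, co_d, co_d, Φ.pi_sum]
    congr 1
    refine Finset.sum_congr rfl fun i hi => ?_
    rw [hv', if_neg (fun hh => hr (Finset.mem_of_mem_erase hh)), ← Φ.pi_D]
    rcases Φ.sg_cases i (r.erase i) with hs | hs <;> simp [hs, Φ.pi_neg]

end Frame


/-! ### Grading -/

theorem logForm_cons {F : Type*} [Field F] {n : ℕ} (c : F) (x : Fin n → F) :
    logForm F (Fin.cons c x : Fin (n + 1) → F) = dLog F c * logForm F x := by
  unfold logForm
  rw [List.ofFn_succ, List.prod_cons]
  simp

theorem logForm_mem {F : Type*} [Field F] {n : ℕ} (x : Fin n → F) :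
    logForm F x ∈ omegaPow F n := by
  induction n with
  | zero =>
    unfold logForm omegaPow
    simp
  | succ n ih =>
    rw [← Fin.cons_self_tail x, logForm_cons, omegaPow, pow_succ']
    exact Submodule.mul_mem_mul ⟨_, rfl⟩ (ih _)

theorem dForm_mul_mem {F : Type*} [Field F] {n : ℕ} (b : F) (η : DF F) (h : η ∈ omegaPred F n) :
    dForm F b * η ∈ omegaPow F n := by
  cases n with
  | zero =>
    have : η = 0 := h
    rw [this, mul_zero]; exact Submodule.zero_mem _
  | succ n =>
    rw [omegaPow, pow_succ']
    exact Submodule.mul_mem_mul ⟨_, rfl⟩ h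

theorem omegaPow_induction {F : Type*} [Field F] {P : ℕ → DF F → Prop}
    (hadd : ∀ n v w, P n v → P n w → P n (v + w))
    (h1 : ∀ a : F, P 0 (a • 1))
    (hmul : ∀ n (m : KaehlerDifferential ℤ F) w, w ∈ omegaPow F n → P n w →
      P (n + 1) (ExteriorAlgebra.ι F m * w))
    {n : ℕ} {w : DF F} (hw : w ∈ omegaPow F n) : P n w := by
  induction n generalizing w with
  | zero =>
    rw [omegaPow, pow_zero, Submodule.mem_one] at hw
    obtain ⟨a, rfl⟩ := hw
    rw [Algebra.algebraMap_eq_smul_one]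
    exact h1 a
  | succ n ih =>
    rw [omegaPow, pow_succ'] at hw
    induction hw using Submodule.mul_induction_on' with
    | mem_mul_mem m hm w hw =>
      obtain ⟨m, rfl⟩ := hm
      exact hmul n m w hw (ih hw)
    | add v _ w _ hv hw => exact hadd _ _ _ hv hw

/-- `Ω_F^n` is additively generated by the forms `a • logForm x`. -/
theorem omegaPow_closure {F : Type*} [Field F] {n : ℕ} {w : DF F} (hw : w ∈ omegaPow F n) :
    w ∈ AddSubmonoid.closure {w | ∃ (a : F) (x : Fin n → F), w = a • logForm F x} := by
  refine omegaPow_induction (P := fun n w => w ∈ AddSubmonoid.closure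
    {w | ∃ (a : F) (x : Fin n → F), w = a • logForm F x}) ?_ ?_ ?_ hw
  · intro n v w hv hw
    exact AddSubmonoid.add_mem _ hv hw
  · intro a
    exact AddSubmonoid.subset_closure ⟨a, Fin.elim0, by simp [logForm]⟩
  · intro n m w hmem ih
    clear hmem
    have hm : m ∈ Submodule.span F (Set.range (KaehlerDifferential.D ℤ F)) := by
      rw [KaehlerDifferential.span_range_derivation]; trivial
    induction ih using AddSubmonoid.closure_induction with
    | zero => rw [mul_zero]; exact AddSubmonoid.zero_mem _
    | add v w _ _ hv hw => rw [mul_add]; exact AddSubmonoid.add_mem _ hv hw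
    | mem w hw =>
      obtain ⟨a, x, rfl⟩ := hw
      induction hm using Submodule.span_induction generalizing a with
      | zero => rw [map_zero, zero_mul]; exact AddSubmonoid.zero_mem _
      | add m m' _ _ h h' =>
        rw [map_add, add_mul]
        exact AddSubmonoid.add_mem _ (h _) (h' _)
      | smul c m _ h =>
        rw [map_smul, smul_mul_assoc, ← mul_smul_comm, smul_smul]
        exact h _
      | mem m hm =>
        obtain ⟨c, rfl⟩ := hm
        by_cases hc : c = 0
        · rw [hc, map_zero, map_zero, zero_mul]; exact AddSubmonoid.zero_mem _
        · refine AddSubmonoid.subset_closure ⟨a * c, Fin.cons c x, ?_⟩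
          rw [logForm_cons, dLog_eq, mul_smul_comm, mul_smul, smul_mul_assoc, smul_smul c,
            mul_inv_cancel₀ hc, one_smul]
          rfl

theorem omegaPow_log_induction {F : Type*} [Field F] {n : ℕ} {P : DF F → Prop}
    (h0 : P 0) (hadd : ∀ v w, P v → P w → P (v + w))
    (hlog : ∀ (a : F) (x : Fin n → F), P (a • logForm F x))
    {w : DF F} (hw : w ∈ omegaPow F n) : P w := by
  have key := omegaPow_closure hw
  clear hw
  induction key using AddSubmonoid.closure_induction with
  | zero => exact h0
  | add v w _ _ hv hw => exact hadd _ _ hv hw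
  | mem w hw => obtain ⟨a, x, rfl⟩ := hw; exact hlog a x

namespace Frame

variable {p : ℕ} {E : Type*} [Field E] {ι : Type*} [LinearOrder ι] (Φ : Frame p E ι)

theorem eq_sum (w : DF E) : w = ∑ s ∈ (Φ.X.repr w).support, Φ.co w s • Φ.X s := by
  conv_lhs => rw [← Φ.X.linearCombination_repr w]
  rfl

theorem X_mem (s : Finset ι) : Φ.X s ∈ omegaPow E s.card := by
  rw [Φ.X_eq_logForm s rfl]; exact logForm_mem _

theorem mem_omegaPow_iff {n : ℕ} {w : DF E} :
    w ∈ omegaPow E n ↔ ∀ s, s.card ≠ n → Φ.co w s = 0 := by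
  constructor
  · intro hw
    refine omegaPow_induction (P := fun n w => ∀ s : Finset ι, s.card ≠ n → Φ.co w s = 0)
      ?_ ?_ ?_ hw
    · intro n v w hv hw s hs
      rw [co_add, hv s hs, hw s hs, add_zero]
    · intro a s hs
      rw [← Φ.X_empty, co_smul, co_X, if_neg, mul_zero]
      rintro rfl; simp at hs
    · intro n m w _ ih s hs
      rw [co_iota_mul, Finset.sum_eq_zero]
      intro i hi
      rw [ih, mul_zero, smul_zero]
      rw [Finset.card_erase_of_mem hi]
      have : 0 < s.card := Finset.card_pos.2 ⟨i, hi⟩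
      omega
  · intro h
    rw [Φ.eq_sum w]
    refine Submodule.sum_mem _ fun s hs => ?_
    by_cases hc : s.card = n
    · subst hc
      exact Submodule.smul_mem _ _ (Φ.X_mem s)
    · rw [h s hc, zero_smul]; exact Submodule.zero_mem _

theorem mem_omegaPred_iff {n : ℕ} {w : DF E} :
    w ∈ omegaPred E n ↔ ∀ s, s.card + 1 ≠ n → Φ.co w s = 0 := by
  cases n with
  | zero =>
    change w = 0 ↔ _
    constructor
    · rintro rfl s _; exact Φ.co_zero s
    · intro h; exact Φ.ext fun s => by rw [h s (by omega), co_zero]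
  | succ n =>
    change w ∈ omegaPow E n ↔ _
    rw [Φ.mem_omegaPow_iff]
    simp

theorem sp_frob [CharP E p] (hp : p.Prime) (S : DiffStr p E) {n : ℕ} {u : DF E}
    (hu : u ∈ omegaPow E n) : ∃ η ∈ omegaPred E n, S.sp u = Φ.frob hp u + S.d η := by
  rw [Φ.eq_sum u]
  refine Finset.sum_induction _ (fun u => ∃ η ∈ omegaPred E n, S.sp u = Φ.frob hp u + S.d η)
    ?_ ?_ ?_
  · rintro a b ⟨η, hη, h⟩ ⟨η', hη', h'⟩
    refine ⟨η + η', Submodule.add_mem _ hη hη', ?_⟩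
    rw [map_add, map_add, frob_add, h, h']; abel
  · refine ⟨0, Submodule.zero_mem _, ?_⟩
    have := Φ.frob_smul hp 0 0
    rw [zero_smul, zero_pow hp.ne_zero, zero_smul] at this
    rw [map_zero, map_zero, this, add_zero]
  · intro s hs
    have hc : s.card = n := by
      by_contra hc
      rw [Finsupp.mem_support_iff] at hs
      exact hs (Φ.mem_omegaPow_iff.1 hu s hc)
    obtain ⟨η, hη, h⟩ := S.sp_log n (Φ.co u s) (fun k => Φ.t (s.orderEmbOfFin hc k))
    rw [← Φ.X_eq_logForm s hc] at h
    refine ⟨η, hη, ?_⟩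
    rw [h, frob_smul]
    congr 2
    refine Φ.ext fun r => ?_
    rw [co_frob, co_X]
    split_ifs
    · simp
    · rw [zero_pow hp.ne_zero]

/-- Keep only the coordinates satisfying `P`. -/
theorem exists_proj (w : DF E) (P : Finset ι → Prop) [DecidablePred P] :
    ∃ w' : DF E, ∀ s, Φ.co w' s = if P s then Φ.co w s else 0 := by
  refine ⟨Φ.X.repr.symm ((Φ.X.repr w).filter P), fun s => ?_⟩
  unfold co
  rw [LinearEquiv.apply_symm_apply, Finsupp.filter_apply]

theorem theoremA_graded [CharP E p] (hp : p.Prime) [WellFoundedLT ι] (S : DiffStr p E) (x : ι)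
    (hx : ∀ i, i ≤ x) {n : ℕ} (W : DF E) (hn : W ∈ omegaPow E n)
    (hW : ∀ s, x ∈ s → Φ.co W s = 0)
    (hW' : ∀ s, Φ.D x (Φ.co W s) = 0) (u v : DF E)
    (h : W = Φ.frob hp u - u + S.d v) :
    ∃ u' ∈ omegaPow E n, ∃ v' ∈ omegaPred E n, W = Φ.frob hp u' - u' + S.d v' ∧
      (∀ s, x ∈ s → Φ.co u' s = 0) ∧
      (∀ s, Φ.D x (Φ.co u' s) = 0) ∧ (∀ s, x ∈ s → Φ.co v' s = 0) ∧
      (∀ s, Φ.D x (Φ.co v' s) = 0) := by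
  obtain ⟨u, v, h, h1, h2, h3, h4⟩ := Φ.theoremA hp S x hx W hW hW' u v h
  obtain ⟨u', hu'⟩ := Φ.exists_proj u (fun s => s.card = n)
  obtain ⟨v', hv'⟩ := Φ.exists_proj v (fun s => s.card + 1 = n)
  refine ⟨u', Φ.mem_omegaPow_iff.2 fun s hs => by rw [hu', if_neg hs], v',
    Φ.mem_omegaPred_iff.2 fun s hs => by rw [hv', if_neg hs], Φ.ext fun s => ?_, ?_, ?_, ?_, ?_⟩
  · rw [co_add, co_sub, co_frob, hu', co_d]
    by_cases hc : s.card = n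
    · rw [if_pos hc, h, co_add, co_sub, co_frob, co_d]
      congr 1
      refine Finset.sum_congr rfl fun i hi => ?_
      rw [hv', if_pos]
      rw [Finset.card_erase_of_mem hi]
      have : 0 < s.card := Finset.card_pos.2 ⟨i, hi⟩
      omega
    · rw [if_neg hc, Φ.mem_omegaPow_iff.1 hn s hc, zero_pow hp.ne_zero, Finset.sum_eq_zero]
      · simp
      intro i hi
      rw [hv', if_neg]
      · simp
      rw [Finset.card_erase_of_mem hi]
      have : 0 < s.card := Finset.card_pos.2 ⟨i, hi⟩
      omega
  · intro s hs; rw [hu', h1 s hs, ite_self]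
  · intro s; rw [hu']; split_ifs
    · exact h2 s
    · simp
  · intro s hs; rw [hv', h3 s hs, ite_self]
  · intro s; rw [hv']; split_ifs
    · exact h4 s
    · simp

end Frame


/-! ### Field theory -/

open Polynomial in
theorem exists_der_ext {p : ℕ} (hp : p.Prime) {K L : Type*} [Field K] [Field L] [Algebra K L]
    [CharP L p] (b : K) (β : L) (hβ : β ^ p = algebraMap K L b)
    (hgen : Algebra.adjoin K {β} = ⊤) (hnot : ∀ c : K, algebraMap K L c ≠ β)
    (δ : K →+ L) (hδ : ∀ x y, δ (x * y) = algebraMap K L x * δ y + algebraMap K L y * δ x)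
    (hb : δ b = 0) (t : L) :
    ∃ δ' : Derivation ℤ L L, (∀ a, δ' (algebraMap K L a) = δ a) ∧ δ' β = t := by
  have hfact := Fact.mk hp
  have hirr : Irreducible (X ^ p - C b : K[X]) := by
    refine X_pow_sub_C_irreducible_of_prime hp fun c hc => hnot c ?_
    apply frobenius_inj L p
    rw [frobenius_def, frobenius_def, hβ, ← hc, map_pow]
  have hfirr := Fact.mk hirr
  let ψ : AdjoinRoot (X ^ p - C b : K[X]) →ₐ[K] L :=
    AdjoinRoot.liftAlgHom _ (Algebra.ofId K L) β (by
      simp [eval₂_sub, hβ])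
  have hψr : ψ (AdjoinRoot.root _) = β := by simp [ψ]
  have hψ : Function.Bijective ψ := by
    refine ⟨ψ.toRingHom.injective, ?_⟩
    rw [← AlgHom.range_eq_top, eq_top_iff, ← hgen, Algebra.adjoin_le_iff]
    rintro _ rfl
    exact ⟨_, hψr⟩
  let e := AlgEquiv.ofBijective ψ hψ
  have hδ1 : δ 1 = 0 := by
    have := hδ 1 1
    simpa using this
  let i0 : K →+* TrivSqZeroExt L L :=
    { toFun := fun a => TrivSqZeroExt.inl (algebraMap K L a) + TrivSqZeroExt.inr (δ a)
      map_one' := by rw [map_one, hδ1]; simp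
      map_zero' := by rw [map_zero, map_zero]; simp
      map_add' := fun x y => by
        ext <;> simp
      map_mul' := fun x y => by
        ext
        · simp
        · simp [hδ, mul_comm] }
  have hpow : ∀ m : ℕ, (TrivSqZeroExt.inl β + TrivSqZeroExt.inr t : TrivSqZeroExt L L) ^ (m + 1) =
      TrivSqZeroExt.inl (β ^ (m + 1)) + TrivSqZeroExt.inr (((m + 1 : ℕ) : L) * β ^ m * t) := by
    intro m
    induction m with
    | zero => simp
    | succ m ih =>
      rw [pow_succ, ih]
      ext
      · simp [pow_succ]
      · simp; ring
  let φ : AdjoinRoot (X ^ p - C b : K[X]) →+* TrivSqZeroExt L L :=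
    AdjoinRoot.lift i0 (TrivSqZeroExt.inl β + TrivSqZeroExt.inr t) (by
      obtain ⟨m, hm⟩ : ∃ m, p = m + 1 := ⟨p - 1, by have := hp.two_le; omega⟩
      rw [eval₂_sub, eval₂_X_pow, eval₂_C]
      conv_lhs => rw [hm, hpow, ← hm, CharP.cast_eq_zero, hβ]
      simp [i0, hb])
  have hfst : ∀ a, (φ a).fst = ψ a := by
    intro a
    have : (TrivSqZeroExt.fstHom K L L).toRingHom.comp φ = ψ.toRingHom := by
      apply AdjoinRoot.ringHom_ext
      · ext a
        simp [φ, ψ, i0]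
      · simp [φ, ψ]
    exact congrArg (fun f => f a) this
  refine ⟨Derivation.mk' (AddMonoidHom.toIntLinearMap
    { toFun := fun a => (φ (e.symm a)).snd
      map_zero' := by simp
      map_add' := by intro x y; simp }) ?_, ?_, ?_⟩
  · intro x y
    have hx : (φ (e.symm x)).fst = x := by rw [hfst]; exact e.apply_symm_apply x
    have hy : (φ (e.symm y)).fst = y := by rw [hfst]; exact e.apply_symm_apply y
    change (φ (e.symm (x * y))).snd = x • (φ (e.symm y)).snd + y • (φ (e.symm x)).snd
    rw [map_mul, map_mul, TrivSqZeroExt.snd_mul, hx, hy]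
    simp [mul_comm]
  · intro a
    change (φ (e.symm (algebraMap K L a))).snd = δ a
    rw [AlgEquiv.commutes, AdjoinRoot.algebraMap_eq]
    simp [φ, i0]
  · change (φ (e.symm β)).snd = t
    have : e.symm β = AdjoinRoot.root _ := by
      rw [AlgEquiv.symm_apply_eq]; exact hψr.symm
    rw [this]
    simp [φ]

open Polynomial in
theorem finrank_adjoin_p {p : ℕ} (hp : p.Prime) {K L : Type*} [Field K] [Field L] [Algebra K L]
    [CharP L p] (b : K) (β : L) (hβ : β ^ p = algebraMap K L b)
    (hnot : ∀ c : K, algebraMap K L c ≠ β) :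
    IsIntegral K β ∧ (minpoly K β).natDegree = p := by
  have hfact := Fact.mk hp
  have hirr : Irreducible (X ^ p - C b : K[X]) := by
    refine X_pow_sub_C_irreducible_of_prime hp fun c hc => hnot c ?_
    apply frobenius_inj L p
    rw [frobenius_def, frobenius_def, hβ, ← hc, map_pow]
  have hm := minpoly.eq_of_irreducible_of_monic hirr (x := β) (by simp [hβ])
    (monic_X_pow_sub_C b hp.ne_zero)
  refine ⟨⟨_, monic_X_pow_sub_C b hp.ne_zero, by simp [hβ]⟩, ?_⟩
  rw [← hm, natDegree_X_pow_sub_C]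

theorem D_ne_zero {p : ℕ} (hp : p.Prime) {F : Type*} [Field F] [CharP F p] (b : F)
    (hb : ∀ c, c ^ p ≠ b) : KaehlerDifferential.D ℤ F b ≠ 0 := by
  classical
  have hfact := Fact.mk hp
  let A : Set (Subfield F) := {K | (∀ a : F, a ^ p ∈ K) ∧ b ∉ K}
  have hA0 : (frobenius F p).fieldRange ∈ A := by
    refine ⟨fun a => ⟨a, rfl⟩, ?_⟩
    rintro ⟨c, hc⟩
    exact hb c hc
  obtain ⟨K, hK⟩ : ∃ K, Maximal (· ∈ A) K := by
    obtain ⟨K, -, hK⟩ := zorn_le_nonempty₀ A (by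
      intro c hcA hc y hy
      have hne : c.Nonempty := ⟨y, hy⟩
      refine ⟨sSup c, ⟨fun a => ?_, ?_⟩, fun z hz => le_sSup hz⟩
      · exact (le_sSup hy : y ≤ sSup c) ((hcA hy).1 a)
      · rw [Subfield.mem_sSup_of_directedOn hne hc.directedOn]
        rintro ⟨s, hs, hbs⟩
        exact (hcA hs).2 hbs) _ hA0
    exact ⟨K, hK⟩
  have hpK : ∀ a : F, a ^ p ∈ K := hK.prop.1
  have hbK : b ∉ K := hK.prop.2
  have hdeg : ∀ c : F, c ∉ K → IsIntegral K c ∧ (minpoly K c).natDegree = p := by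
    intro c hc
    refine finrank_adjoin_p hp (⟨c ^ p, hpK c⟩ : K) c rfl ?_
    rintro ⟨d, hd⟩ rfl
    exact hc hd
  have hmem : ∀ c : F, c ∉ K → b ∈ IntermediateField.adjoin K {c} := by
    intro c hc
    by_contra hn
    have hle : K ≤ (IntermediateField.adjoin K {c}).toSubfield := by
      intro a ha
      exact (IntermediateField.adjoin K {c}).algebraMap_mem ⟨a, ha⟩
    have := hK.2 (y := (IntermediateField.adjoin K {c}).toSubfield)
      ⟨fun a => hle (hpK a), hn⟩ hle
    exact hc (this (IntermediateField.mem_adjoin_simple_self K c))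
  have htop : IntermediateField.adjoin K {b} = ⊤ := by
    rw [eq_top_iff]
    intro c _
    by_cases hc : c ∈ K
    · exact (IntermediateField.adjoin K {b}).algebraMap_mem ⟨c, hc⟩
    have hfd : FiniteDimensional K (IntermediateField.adjoin K {c}) :=
      IntermediateField.adjoin.finiteDimensional (hdeg c hc).1
    have heq : IntermediateField.adjoin K {b} = IntermediateField.adjoin K {c} := by
      refine IntermediateField.eq_of_le_of_finrank_eq ?_ ?_
      · rw [IntermediateField.adjoin_simple_le_iff]; exact hmem c hc
      · rw [IntermediateField.adjoin.finrank (hdeg b hbK).1,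
          IntermediateField.adjoin.finrank (hdeg c hc).1, (hdeg b hbK).2, (hdeg c hc).2]
    rw [heq]
    exact IntermediateField.mem_adjoin_simple_self K c
  have hadj : Algebra.adjoin K {b} = ⊤ := by
    rw [← IntermediateField.adjoin_simple_toSubalgebra_of_isAlgebraic
      ((hdeg b hbK).1.isAlgebraic), htop]
    rfl
  obtain ⟨δ, -, h1⟩ := exists_der_ext hp (⟨b ^ p, hpK b⟩ : K) b rfl hadj
    (by rintro ⟨d, hd⟩ rfl; exact hbK hd) 0 (by simp) rfl 1
  intro h0
  have : δ b = 0 := by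
    rw [← Derivation.liftKaehlerDifferential_comp_D, h0, map_zero]
  rw [h1] at this
  exact one_ne_zero this


/-! ### Construction of frames -/

theorem exists_order (ι : Type*) (x : ι) :
    ∃ _ : LinearOrder ι, WellFoundedLT ι ∧ ∀ i : ι, i ≤ x := by
  classical
  let o : LinearOrder ι := linearOrderOfSTO (WellOrderingRel (α := ι))
  have hwf : WellFoundedLT ι := ⟨(WellOrderingRel.isWellOrder (α := ι)).wf⟩
  let f : ι → WithTop ι := fun i => if i = x then ⊤ else (i : WithTop ι)
  have hf : Function.Injective f := by
    intro i j h
    by_cases hi : i = x <;> by_cases hj : j = x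
    · rw [hi, hj]
    · simp [f, hi, hj] at h
    · simp [f, hi, hj] at h
    · simpa [f, hi, hj] using h
  refine ⟨LinearOrder.lift' f hf, ⟨?_⟩, ?_⟩
  · exact InvImage.wf f (wellFounded_lt (α := WithTop ι))
  · intro i
    change f i ≤ f x
    have : f x = ⊤ := by simp [f]
    rw [this]; exact le_top

theorem der_eq_zero {K M : Type*} [Field K] [AddCommGroup M] [Module K M]
    {ι : Type*} (bas : Module.Basis ι K (KaehlerDifferential ℤ K)) (t : ι → K)
    (hb : ∀ i, bas i = (t i)⁻¹ • KaehlerDifferential.D ℤ K (t i))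
    (δ : Derivation ℤ K M) (h : ∀ i, δ (t i) = 0) (a : K) : δ a = 0 := by
  have : δ.liftKaehlerDifferential = 0 := by
    refine bas.ext fun i => ?_
    rw [hb, map_smul, Derivation.liftKaehlerDifferential_comp_D, h]
    simp
  rw [← Derivation.liftKaehlerDifferential_comp_D, this]; rfl

theorem der_iterate_mul {K : Type*} [Field K] (D : Derivation ℤ K K) (n : ℕ) (a b : K) :
    (D)^[n] (a * b) = ∑ k ∈ Finset.range (n + 1),
      ((n.choose k : ℕ) : K) * ((D)^[k] a * (D)^[n - k] b) := by
  let A : Module.End ℤ (TensorProduct ℤ K K) := TensorProduct.map D.toLinearMap LinearMap.id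
  let B : Module.End ℤ (TensorProduct ℤ K K) := TensorProduct.map LinearMap.id D.toLinearMap
  have hA1 : ∀ x y : K, A (x ⊗ₜ[ℤ] y) = D x ⊗ₜ[ℤ] y := fun _ _ => rfl
  have hB1 : ∀ x y : K, B (x ⊗ₜ[ℤ] y) = x ⊗ₜ[ℤ] D y := fun _ _ => rfl
  have hAB : Commute A B := by
    refine TensorProduct.ext' fun x y => ?_
    change A (B (x ⊗ₜ[ℤ] y)) = B (A (x ⊗ₜ[ℤ] y))
    rw [hA1, hB1, hA1, hB1]
  have hA : ∀ (k : ℕ) (x y : K), (A ^ k) (x ⊗ₜ[ℤ] y) = ((D)^[k] x) ⊗ₜ[ℤ] y := by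
    intro k
    induction k with
    | zero => intro x y; simp
    | succ k ih =>
      intro x y
      rw [pow_succ, Module.End.mul_apply, hA1, ih, Function.iterate_succ_apply]
  have hB : ∀ (k : ℕ) (x y : K), (B ^ k) (x ⊗ₜ[ℤ] y) = x ⊗ₜ[ℤ] ((D)^[k] y) := by
    intro k
    induction k with
    | zero => intro x y; simp
    | succ k ih =>
      intro x y
      rw [pow_succ, Module.End.mul_apply, hB1, ih, Function.iterate_succ_apply]
  clear_value A B
  have h1 : ∀ z, D (LinearMap.mul' ℤ K z) = LinearMap.mul' ℤ K ((A + B) z) := by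
    intro z
    induction z using TensorProduct.induction_on with
    | zero => simp
    | tmul x y =>
      rw [LinearMap.add_apply, hA1, hB1, map_add, LinearMap.mul'_apply, LinearMap.mul'_apply,
        LinearMap.mul'_apply, Derivation.leibniz, smul_eq_mul, smul_eq_mul]
      ring
    | add x y hx hy => rw [map_add, map_add, hx, hy, map_add, map_add]
  have h2 : ∀ (m : ℕ) z, (D)^[m] (LinearMap.mul' ℤ K z) = LinearMap.mul' ℤ K (((A + B) ^ m) z) := by
    intro m
    induction m with
    | zero => intro z; simp
    | succ m ih =>
      intro z
      rw [Function.iterate_succ_apply, h1, ih, pow_succ, Module.End.mul_apply]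
  have h3 := h2 n (a ⊗ₜ[ℤ] b)
  rw [LinearMap.mul'_apply] at h3
  rw [h3, hAB.add_pow, LinearMap.sum_apply, map_sum]
  refine Finset.sum_congr rfl fun k _ => ?_
  rw [← nsmul_eq_mul', LinearMap.smul_apply, map_nsmul, Module.End.mul_apply, hB, hA,
    LinearMap.mul'_apply, nsmul_eq_mul]

/-- The `p`-th power of a derivation in characteristic `p`. -/
def derPow {p : ℕ} (hp : p.Prime) {K : Type*} [Field K] [CharP K p] (D : Derivation ℤ K K) :
    Derivation ℤ K K :=
  Derivation.mk' (AddMonoidHom.toIntLinearMap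
    { toFun := (D)^[p]
      map_zero' := iterate_map_zero D p
      map_add' := iterate_map_add D p }) (by
    intro a b
    change (D)^[p] (a * b) = a • (D)^[p] b + b • (D)^[p] a
    rw [der_iterate_mul, Finset.sum_range_succ, Finset.sum_eq_single 0]
    · simp [mul_comm]
    · intro k hk hk0
      rw [Finset.mem_range] at hk
      rw [(CharP.cast_eq_zero_iff K p _).2 (hp.dvd_choose_self hk0 hk), zero_mul]
    · intro h; simp [hp.pos] at h)

theorem derPow_apply {p : ℕ} (hp : p.Prime) {K : Type*} [Field K] [CharP K p]
    (D : Derivation ℤ K K) (a : K) : derPow hp D a = (D)^[p] a := rfl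

theorem exists_frame {p : ℕ} (hp : p.Prime) {K : Type*} [Field K] [CharP K p]
    {ι : Type*} [LinearOrder ι] (bas : Module.Basis ι K (KaehlerDifferential ℤ K)) (t : ι → K)
    (ht : ∀ i, t i ≠ 0) (hb : ∀ i, bas i = (t i)⁻¹ • KaehlerDifferential.D ℤ K (t i)) :
    ∃ Φ : Frame p K ι, Φ.bas = bas ∧ Φ.t = t := by
  let D : ι → Derivation ℤ K K := fun i => (bas.coord i).compDer (KaehlerDifferential.D ℤ K)
  have hD : ∀ i a, D i a = bas.repr (KaehlerDifferential.D ℤ K a) i := fun i a => rfl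
  have Dt : ∀ i j, D i (t j) = if i = j then t j else 0 := by
    intro i j
    have : KaehlerDifferential.D ℤ K (t j) = t j • bas j := by
      rw [hb, smul_smul, mul_inv_cancel₀ (ht j), one_smul]
    rw [hD, this, map_smul, Module.Basis.repr_self, Finsupp.smul_apply, Finsupp.single_apply]
    by_cases h : i = j
    · simp [h]
    · simp [h, Ne.symm h]
  have hit : ∀ i j (m : ℕ), (D i)^[m + 1] (t j) = if i = j then t j else 0 := by
    intro i j m
    induction m with
    | zero => simpa using Dt i j
    | succ m ih =>
      rw [Function.iterate_succ_apply', ih]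
      split_ifs with h
      · rw [Dt, if_pos h]
      · simp
  refine ⟨{ D := D, t := t, t_ne := ht, Dt := Dt, comm := ?_, pw := ?_, fin := ?_, bas := bas,
            bas_eq := hb, D_eq := hD }, rfl, rfl⟩
  · intro i j a
    have := der_eq_zero bas t hb ⁅D i, D j⁆ (by
      intro k
      rw [Derivation.commutator_apply, Dt, Dt]
      by_cases h1 : j = k <;> by_cases h2 : i = k
      · subst h1; subst h2; simp
      · rw [if_pos h1, if_neg h2, Dt, if_neg h2, map_zero, sub_zero]
      · rw [if_neg h1, if_pos h2, Dt, if_neg h1, map_zero, sub_zero]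
      · rw [if_neg h1, if_neg h2, map_zero, map_zero, sub_zero]) a
    rw [Derivation.commutator_apply, sub_eq_zero] at this
    exact this
  · intro i a
    have := der_eq_zero bas t hb (derPow hp (D i) - D i) (by
      intro k
      obtain ⟨m, hm⟩ : ∃ m, p = m + 1 := ⟨p - 1, by have := hp.two_le; omega⟩
      rw [Derivation.sub_apply, derPow_apply, Dt]
      conv_lhs => rw [hm]
      rw [hit, sub_self]) a
    rw [Derivation.sub_apply, derPow_apply, sub_eq_zero] at this
    exact this
  · intro a
    refine (Finsupp.hasFiniteSupport (bas.repr (KaehlerDifferential.D ℤ K a))).subset ?_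
    intro i hi
    exact hi

universe u v

theorem frame_of_dual {p : ℕ} (hp : p.Prime) {K : Type*} [Field K] [CharP K p]
    {ι : Type*} [LinearOrder ι] (t : ι → K) (δ : ι → Derivation ℤ K K)
    (hδ : ∀ i j, δ i (t j) = if i = j then 1 else 0)
    (hspan : ∀ a, KaehlerDifferential.D ℤ K a ∈
      Submodule.span K (Set.range fun i => KaehlerDifferential.D ℤ K (t i))) :
    ∃ Φ : Frame p K ι, Φ.t = t := by
  have ht : ∀ i, t i ≠ 0 := by
    intro i h
    have := hδ i i
    rw [h, map_zero, if_pos rfl] at this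
    exact zero_ne_one this
  have hli : LinearIndependent K (fun i => (t i)⁻¹ • KaehlerDifferential.D ℤ K (t i)) := by
    refine LinearIndependent.of_pairwise_dual_eq_zero_one _
      (fun i => t i • (δ i).liftKaehlerDifferential) ?_ ?_
    · intro i j hij
      rw [LinearMap.smul_apply, map_smul, Derivation.liftKaehlerDifferential_comp_D, hδ, if_neg]
      · simp
      · exact hij
    · intro i
      rw [LinearMap.smul_apply, map_smul, Derivation.liftKaehlerDifferential_comp_D, hδ,
        if_pos rfl]
      simp [ht i]
  have hsp : ⊤ ≤ Submodule.span K
      (Set.range fun i => (t i)⁻¹ • KaehlerDifferential.D ℤ K (t i)) := by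
    rw [← KaehlerDifferential.span_range_derivation, Submodule.span_le]
    rintro _ ⟨a, rfl⟩
    refine (Submodule.span_le.2 ?_) (hspan a)
    rintro _ ⟨i, rfl⟩
    have : KaehlerDifferential.D ℤ K (t i) =
        t i • ((t i)⁻¹ • KaehlerDifferential.D ℤ K (t i)) := by
      rw [smul_smul, mul_inv_cancel₀ (ht i), one_smul]
    change KaehlerDifferential.D ℤ K (t i) ∈ _
    rw [this]
    exact Submodule.smul_mem _ _ (Submodule.subset_span ⟨i, rfl⟩)
  obtain ⟨Φ, _, h⟩ := exists_frame hp (Module.Basis.mk hli hsp) t ht (fun i => by simp)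
  exact ⟨Φ, h⟩

theorem exists_dual {K : Type*} [Field K] (s : Set (KaehlerDifferential ℤ K))
    (hs : LinearIndepOn K id s) (hs' : s ⊆ Set.range (KaehlerDifferential.D ℤ K)) :
    ∃ (B : Set (KaehlerDifferential ℤ K)) (δ : B → Derivation ℤ K K),
      s ⊆ B ∧ B ⊆ Set.range (KaehlerDifferential.D ℤ K) ∧
      (∀ t : B → K, (∀ i, KaehlerDifferential.D ℤ K (t i) = i) →
        (∀ (i j : B) [Decidable (i = j)], δ i (t j) = if i = j then 1 else 0) ∧ ∀ a, KaehlerDifferential.D ℤ K a ∈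
      Submodule.span K (Set.range fun i => KaehlerDifferential.D ℤ K (t i))) := by
  obtain ⟨B, hB, hsB, hspan, hli⟩ := exists_linearIndepOn_id_extension hs hs'
  have hsp : ⊤ ≤ Submodule.span K (Set.range ((↑) : B → KaehlerDifferential ℤ K)) := by
    rw [← KaehlerDifferential.span_range_derivation, Subtype.range_coe, Submodule.span_le]
    exact hspan
  let bas := Module.Basis.mk (v := ((↑) : B → KaehlerDifferential ℤ K)) hli hsp
  refine ⟨B, fun i => (bas.coord i).compDer (KaehlerDifferential.D ℤ K), hsB, hB, fun t ht => ?_⟩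
  refine ⟨fun i j _ => ?_, fun a => ?_⟩
  · change bas.coord i (KaehlerDifferential.D ℤ K (t j)) = _
    have : KaehlerDifferential.D ℤ K (t j) = bas j := by
      rw [ht]; exact (Module.Basis.mk_apply hli hsp j).symm
    rw [this, Module.Basis.coord_apply, Module.Basis.repr_self]
    by_cases hij : i = j
    · rw [if_pos hij, hij, Finsupp.single_eq_same]
    · rw [if_neg hij, Finsupp.single_eq_of_ne]
      exact hij
  · simp only [ht]
    exact hsp trivial

/-- Frames in the trivial case `E = F`. -/
theorem setup_trivial {p : ℕ} (hp : p.Prime) {F : Type u} {E : Type v} [Field F] [Field E]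
    [Algebra F E] [CharP F p] [CharP E p] (hbij : Function.Bijective (algebraMap F E)) :
    ∃ (ι : Type u) (_ : LinearOrder ι) (ΦF : Frame p F ι) (ΦE : Frame p E ι),
      ∀ i, ΦE.t i = algebraMap F E (ΦF.t i) := by
  classical
  obtain ⟨B, δ, -, hB, h⟩ := exists_dual (K := F) ∅ (linearIndepOn_empty _ _) (by simp)
  let o : LinearOrder B := linearOrderOfSTO (WellOrderingRel (α := B))
  choose t ht using fun i : B => hB i.2
  obtain ⟨h1, h2⟩ := h t ht
  obtain ⟨ΦF, hF⟩ := frame_of_dual hp t δ (fun i j => by rw [h1]; congr) h2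
  let e := RingEquiv.ofBijective (algebraMap F E) hbij
  have he : ∀ a, e a = algebraMap F E a := fun _ => rfl
  let δ' : B → Derivation ℤ E E := fun i => Derivation.mk'
    (AddMonoidHom.toIntLinearMap
      ((e : F →+ E).comp (((δ i).toLinearMap.toAddMonoidHom).comp (e.symm : E →+ F)))) (by
      intro a b
      change e (δ i (e.symm (a * b))) = a • e (δ i (e.symm b)) + b • e (δ i (e.symm a))
      rw [map_mul, Derivation.leibniz]
      simp)
  have hδ' : ∀ i a, δ' i a = e (δ i (e.symm a)) := fun _ _ => rfl
  obtain ⟨ΦE, hE⟩ := frame_of_dual hp (fun i => algebraMap F E (t i)) δ' (by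
      intro i j
      rw [hδ', ← he, e.symm_apply_apply, h1]
      split_ifs <;> simp) (by
      intro a
      obtain ⟨a, rfl⟩ := hbij.2 a
      rw [← KaehlerDifferential.map_D ℤ ℤ F E]
      have := h2 a
      refine Submodule.span_induction (p := fun m _ => KaehlerDifferential.map ℤ ℤ F E m ∈
        Submodule.span E (Set.range fun i => KaehlerDifferential.D ℤ E (algebraMap F E (t i))))
        ?_ ?_ ?_ ?_ this
      · rintro _ ⟨i, rfl⟩
        rw [KaehlerDifferential.map_D]
        exact Submodule.subset_span ⟨i, rfl⟩
      · rw [map_zero]; exact Submodule.zero_mem _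
      · intro x y _ _ hx hy
        rw [map_add]; exact Submodule.add_mem _ hx hy
      · intro c x _ hx
        rw [map_smul, ← algebraMap_smul E c]
        exact Submodule.smul_mem _ _ hx)
  exact ⟨B, o, ΦF, ΦE, fun i => by rw [hE, hF]⟩

/-- Frames adapted to a purely inseparable extension of degree `p`. -/
theorem setup_main {p : ℕ} (hp : p.Prime) {F : Type u} {E : Type v} [Field F] [Field E]
    [Algebra F E] [CharP F p] [CharP E p] (b : F) (β : E) (hβ : β ^ p = algebraMap F E b)
    (hgen : Algebra.adjoin F {β} = ⊤) (hnot : ∀ c : F, algebraMap F E c ≠ β) :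
    ∃ (ι : Type u) (_ : LinearOrder ι) (_ : WellFoundedLT ι) (x : ι)
      (ΦF : Frame p F ι) (ΦE : Frame p E ι), (∀ i, i ≤ x) ∧ ΦF.t x = b ∧
      (∀ i, i ≠ x → ΦE.t i = algebraMap F E (ΦF.t i)) ∧
      (∀ a, ΦE.D x (algebraMap F E a) = 0) ∧
      (∀ a, ΦE.D x a = 0 → ∃ c, algebraMap F E c = a) := by
  classical
  have hfact := Fact.mk hp
  have hb : ∀ c : F, c ^ p ≠ b := by
    rintro c rfl
    apply hnot c
    apply frobenius_inj E p
    rw [frobenius_def, frobenius_def, hβ, map_pow]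
  have hDb := D_ne_zero hp b hb
  obtain ⟨B, δ, hsB, hB, h⟩ := exists_dual (K := F) {KaehlerDifferential.D ℤ F b}
    (LinearIndepOn.singleton (v := id) hDb) (by rintro _ rfl; exact ⟨b, rfl⟩)
  let x : B := ⟨KaehlerDifferential.D ℤ F b, hsB rfl⟩
  obtain ⟨o, hwf, hx⟩ := exists_order B x
  choose t0 ht0 using fun i : B => hB i.2
  let t : B → F := fun i => if i = x then b else t0 i
  have htx : t x = b := if_pos rfl
  have ht : ∀ i, KaehlerDifferential.D ℤ F (t i) = i := by
    intro i
    by_cases hi : i = x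
    · rw [hi, htx]
    · simp only [t, if_neg hi]; exact ht0 i
  obtain ⟨h1, h2⟩ := h t ht
  obtain ⟨ΦF, hF⟩ := frame_of_dual hp t δ (fun i j => by rw [h1]; congr) h2
  have hex : ∀ i : B, ∃ δ' : Derivation ℤ E E,
      (∀ a, δ' (algebraMap F E a) = if i = x then 0 else algebraMap F E (δ i a)) ∧
      δ' β = if i = x then 1 else 0 := by
    intro i
    by_cases hi : i = x
    · obtain ⟨δ', h, h'⟩ := exists_der_ext hp b β hβ hgen hnot 0 (by simp) rfl 1
      exact ⟨δ', fun a => by rw [h, if_pos hi]; rfl, by rw [h', if_pos hi]⟩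
    · obtain ⟨δ', h, h'⟩ := exists_der_ext hp b β hβ hgen hnot
        ((algebraMap F E : F →+ E).comp (δ i).toLinearMap.toAddMonoidHom) (by
          intro a c
          change algebraMap F E (δ i (a * c)) = algebraMap F E a * algebraMap F E (δ i c) +
            algebraMap F E c * algebraMap F E (δ i a)
          rw [Derivation.leibniz]; simp) (by
          change algebraMap F E (δ i b) = 0
          rw [← htx, h1, if_neg hi, map_zero]) 0
      exact ⟨δ', fun a => by rw [h, if_neg hi]; rfl, by rw [h', if_neg hi]⟩
  choose δ' hδ1 hδ2 using hex
  let tE : B → E := fun i => if i = x then β else algebraMap F E (t i)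
  have htEx : tE x = β := if_pos rfl
  have htE : ∀ i, i ≠ x → tE i = algebraMap F E (t i) := fun i hi => if_neg hi
  have hDE : KaehlerDifferential.D ℤ E (algebraMap F E b) = 0 := by
    rw [← hβ, Derivation.leibniz_pow, ← Nat.cast_smul_eq_nsmul E, CharP.cast_eq_zero, zero_smul]
  obtain ⟨ΦE, hE⟩ := frame_of_dual hp tE δ' (by
      intro i j
      by_cases hj : j = x
      · rw [hj, htEx, hδ2]; congr
      · rw [htE j hj, hδ1, h1]
        by_cases hi : i = x
        · rw [if_pos hi, if_neg (by rw [hi]; exact Ne.symm hj)]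
        · rw [if_neg hi]; split_ifs <;> simp) (by
      intro a
      have ha : a ∈ Algebra.adjoin F {β} := by rw [hgen]; trivial
      induction ha using Algebra.adjoin_induction with
      | mem a ha =>
        obtain rfl : a = β := ha
        exact Submodule.subset_span ⟨x, by simp only [htEx]⟩
      | algebraMap a =>
        rw [← KaehlerDifferential.map_D ℤ ℤ F E]
        refine Submodule.span_induction (p := fun m _ => KaehlerDifferential.map ℤ ℤ F E m ∈
          Submodule.span E (Set.range fun i => KaehlerDifferential.D ℤ E (tE i)))
          ?_ ?_ ?_ ?_ (h2 a)
        · rintro _ ⟨i, rfl⟩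
          rw [KaehlerDifferential.map_D]
          by_cases hi : i = x
          · rw [hi, htx, hDE]; exact Submodule.zero_mem _
          · rw [← htE i hi]
            exact Submodule.subset_span ⟨i, rfl⟩
        · rw [map_zero]; exact Submodule.zero_mem _
        · intro x y _ _ hx hy
          rw [map_add]; exact Submodule.add_mem _ hx hy
        · intro c x _ hx
          rw [map_smul, ← algebraMap_smul E c]
          exact Submodule.smul_mem _ _ hx
      | add u v _ _ hu hv => rw [map_add]; exact Submodule.add_mem _ hu hv
      | mul u v _ _ hu hv =>
        rw [Derivation.leibniz]
        exact Submodule.add_mem _ (Submodule.smul_mem _ _ hv) (Submodule.smul_mem _ _ hu))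
  have hk : ∀ a, ΦE.D x (algebraMap F E a) = 0 := by
    intro a
    refine der_eq_zero ΦF.bas ΦF.t ΦF.bas_eq ((ΦE.D x).compAlgebraMap F) ?_ a
    intro i
    change ΦE.D x (algebraMap F E (ΦF.t i)) = 0
    by_cases hi : i = x
    · rw [hi, hF, htx, ← hβ, Derivation.leibniz_pow, ← Nat.cast_smul_eq_nsmul E,
        CharP.cast_eq_zero, zero_smul]
    · rw [hF, ← htE i hi, ← hE, ΦE.Dt, if_neg (Ne.symm hi)]
  refine ⟨B, o, hwf, x, ΦF, ΦE, hx, by rw [hF, htx], fun i hi => by rw [hE, hF, htE i hi], hk, ?_⟩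
  intro a ha
  let A : Subalgebra F E :=
    { carrier := {a | ΦE.D x a = 0}
      mul_mem' := by
        intro u v hu hv
        change ΦE.D x (u * v) = 0
        rw [Derivation.leibniz, show ΦE.D x u = 0 from hu, show ΦE.D x v = 0 from hv]; simp
      add_mem' := by
        intro u v hu hv
        change ΦE.D x (u + v) = 0
        rw [map_add, show ΦE.D x u = 0 from hu, show ΦE.D x v = 0 from hv]; simp
      algebraMap_mem' := hk }
  obtain ⟨hIntegral, hdeg⟩ := finrank_adjoin_p hp b β hβ hnot
  have hfr : Module.finrank F E = p := by
    have h3 := (Algebra.adjoin.powerBasis hIntegral).finrank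
    rw [Algebra.adjoin.powerBasis_dim, hdeg, hgen,
      (Subalgebra.topEquiv (R := F) (A := E)).toLinearEquiv.finrank_eq] at h3
    exact h3
  have hsimple := Subalgebra.isSimpleOrder_of_finrank_prime F E (by rw [hfr]; exact hp)
  rcases eq_bot_or_eq_top A with hA | hA
  · have : a ∈ A := ha
    rw [hA, Algebra.mem_bot] at this
    exact this
  · exfalso
    have : β ∈ A := by rw [hA]; trivial
    have h0 : ΦE.D x β = 0 := this
    have h3 := ΦE.Dt x x
    rw [if_pos rfl] at h3
    rw [hE, htEx, h0] at h3
    exact ΦE.t_ne x (by rw [hE, htEx, ← h3])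


/-! ### Restriction -/

namespace DiffRes

variable {p : ℕ} {F E : Type*} [Field F] [Field E] [Algebra F E]
    {SF : DiffStr p F} {SE : DiffStr p E} (R : DiffRes p F E SF SE)

theorem res_logForm {n : ℕ} (x : Fin n → F) :
    R.res (logForm F x) = logForm E (fun i => algebraMap F E (x i)) := by
  induction n with
  | zero => simp [logForm, R.res_one]
  | succ n ih =>
    have : (fun i => algebraMap F E (x i)) =
        (Fin.cons (algebraMap F E (x 0)) (fun i => algebraMap F E (Fin.tail x i)) :
          Fin (n + 1) → E) := by
      funext i
      refine Fin.cases ?_ (fun j => ?_) i <;> simp [Fin.tail]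
    rw [this, logForm_cons, ← ih, ← Fin.cons_self_tail x, logForm_cons, R.res_mul, dLog_eq,
      dLog_eq, R.res_smul, R.res_dForm, map_inv₀]
    simp

theorem res_pred {n : ℕ} {η : DF F} (h : η ∈ omegaPred F n) : R.res η ∈ omegaPred E n := by
  cases n with
  | zero =>
    have : η = 0 := h
    rw [this, map_zero]; exact Submodule.zero_mem _
  | succ n => exact R.res_grade n η h

theorem d_mem_hRel {K : Type*} [Field K] (S : DiffStr p K) {n : ℕ} {v : DF K}
    (h : v ∈ omegaPred K n) : S.d v ∈ hRel S n :=
  AddSubgroup.mem_sup_right ⟨v, h, rfl⟩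

theorem as_mem_hRel {K : Type*} [Field K] (S : DiffStr p K) {n : ℕ} {v : DF K}
    (h : v ∈ omegaPow K n) : S.sp v - v ∈ hRel S n :=
  AddSubgroup.mem_sup_left ⟨v, h, rfl⟩

theorem mem_hRel_iff {K : Type*} [Field K] (S : DiffStr p K) {n : ℕ} {w : DF K} :
    w ∈ hRel S n ↔ ∃ u ∈ omegaPow K n, ∃ v ∈ omegaPred K n, w = S.sp u - u + S.d v := by
  constructor
  · intro h
    obtain ⟨_, ⟨u, hu, rfl⟩, _, ⟨v, hv, rfl⟩, rfl⟩ := AddSubgroup.mem_sup.1 h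
    exact ⟨u, hu, v, hv, rfl⟩
  · rintro ⟨u, hu, v, hv, rfl⟩
    exact AddSubgroup.add_mem _ (as_mem_hRel S hu) (d_mem_hRel S hv)

theorem res_sp {n : ℕ} {u : DF F} (hu : u ∈ omegaPow F n) :
    ∃ η ∈ omegaPred E n, R.res (SF.sp u) = SE.sp (R.res u) + SE.d η := by
  refine omegaPow_log_induction (P := fun u => ∃ η ∈ omegaPred E n,
    R.res (SF.sp u) = SE.sp (R.res u) + SE.d η) ?_ ?_ ?_ hu
  · exact ⟨0, Submodule.zero_mem _, by simp⟩
  · rintro v w ⟨η, hη, h⟩ ⟨η', hη', h'⟩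
    refine ⟨η + η', Submodule.add_mem _ hη hη', ?_⟩
    simp only [map_add, h, h']; abel
  · intro a x
    obtain ⟨η, hη, h⟩ := SF.sp_log n a x
    obtain ⟨η', hη', h'⟩ := SE.sp_log n (algebraMap F E a) (fun i => algebraMap F E (x i))
    refine ⟨R.res η - η', Submodule.sub_mem _ (R.res_pred hη) hη', ?_⟩
    rw [h, map_add, R.res_smul, R.res_smul, R.res_logForm, h', R.res_d, map_sub, map_pow]
    abel

theorem res_hRel {n : ℕ} {w : DF F} (h : w ∈ hRel SF n) : R.res w ∈ hRel SE n := by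
  obtain ⟨u, hu, v, hv, rfl⟩ := (mem_hRel_iff SF).1 h
  obtain ⟨η, hη, e⟩ := R.res_sp hu
  refine (mem_hRel_iff SE).2 ⟨R.res u, R.res_grade n u hu, η + R.res v,
    Submodule.add_mem _ hη (R.res_pred hv), ?_⟩
  rw [map_add, map_sub, e, R.res_d, map_add]; abel

end DiffRes

/-- Frames over `F` and `E` that agree outside of `N`. -/
structure Compat {p : ℕ} {F E : Type*} [Field F] [Field E] [Algebra F E]
    {ι : Type*} [LinearOrder ι] (ΦF : Frame p F ι) (ΦE : Frame p E ι) (N : Set ι) : Prop where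
  off : ∀ i, i ∉ N → ΦE.t i = algebraMap F E (ΦF.t i)
  on : ∀ i, i ∈ N → dForm E (algebraMap F E (ΦF.t i)) = 0

namespace Compat

variable {p : ℕ} {F E : Type*} [Field F] [Field E] [Algebra F E]
    {SF : DiffStr p F} {SE : DiffStr p E} (R : DiffRes p F E SF SE)
    {ι : Type*} [LinearOrder ι] {ΦF : Frame p F ι} {ΦE : Frame p E ι} {N : Set ι}
    (C : Compat ΦF ΦE N)

theorem X_eq (i : ι) (s : Finset ι) (h : i ∈ s) :
    ΦF.X s = ΦF.sg i (s.erase i) • (ΦF.ell i * ΦF.X (s.erase i)) := by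
  rw [ΦF.ell_mul_X (Finset.notMem_erase i s), Finset.insert_erase h]
  rcases ΦF.sg_cases i (s.erase i) with h | h <;> simp [h]

open Classical in
theorem res_X (C : Compat ΦF ΦE N) (s : Finset ι) :
    R.res (ΦF.X s) = if ∀ i ∈ s, i ∉ N then ΦE.X s else 0 := by
  split_ifs with h
  · rw [ΦF.X_eq_logForm s rfl, ΦE.X_eq_logForm s rfl, R.res_logForm]
    congr 1
    funext k
    rw [C.off _ (h _ (Finset.orderEmbOfFin_mem s rfl k))]
  · push Not at h
    obtain ⟨i, hi, hN⟩ := h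
    rw [X_eq i s hi, map_zsmul, R.res_mul, ΦF.ell_eq, dLog_eq, R.res_smul, R.res_dForm,
      C.on i hN]
    simp

open Classical in
theorem co_res (C : Compat ΦF ΦE N) (w : DF F) (s : Finset ι) :
    ΦE.co (R.res w) s = if ∀ i ∈ s, i ∉ N then algebraMap F E (ΦF.co w s) else 0 := by
  induction w using ΦF.ind with
  | h0 => simp [Frame.co_zero]
  | hadd v w hv hw =>
    rw [map_add, Frame.co_add, hv, hw, Frame.co_add, map_add]
    split_ifs <;> simp
  | hX a r =>
    rw [R.res_smul, C.res_X R, Frame.co_smul, Frame.co_smul, Frame.co_X]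
    by_cases hr : r = s
    · subst hr
      rw [if_pos rfl]
      split_ifs
      · rw [Frame.co_X, if_pos rfl, mul_one, mul_one]
      · rw [Frame.co_zero, mul_zero]
    · rw [if_neg hr]
      split_ifs <;> simp [Frame.co_X, Frame.co_zero, hr]

theorem res_frob (C : Compat ΦF ΦE N) (hp : p.Prime) (w : DF F) :
    R.res (ΦF.frob hp w) = ΦE.frob hp (R.res w) := by
  classical
  refine ΦE.ext fun s => ?_
  rw [ΦE.co_frob, C.co_res R, C.co_res R, ΦF.co_frob]
  split_ifs
  · rw [map_pow]
  · rw [zero_pow hp.ne_zero]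

theorem descend (C : Compat ΦF ΦE N) (w : DF E) (h1 : ∀ s, (∃ i ∈ s, i ∈ N) → ΦE.co w s = 0)
    (h2 : ∀ s, ∃ c, algebraMap F E c = ΦE.co w s) :
    ∃ w' : DF F, R.res w' = w ∧ ∀ s, ΦE.co w s = 0 → ΦF.co w' s = 0 := by
  classical
  choose g hg using fun a : E => (show ∃ c : F, (∃ c', algebraMap F E c' = a) →
      algebraMap F E c = a by
    by_cases h : ∃ c', algebraMap F E c' = a
    · exact ⟨h.choose, fun _ => h.choose_spec⟩
    · exact ⟨0, fun h' => absurd h' h⟩)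
  have hg0 : g 0 = 0 := by
    have := hg 0 ⟨0, map_zero _⟩
    exact (map_eq_zero _).1 this
  have hco : ∀ s, ΦF.co (ΦF.X.repr.symm ((ΦE.X.repr w).mapRange g hg0)) s = g (ΦE.co w s) := by
    intro s
    simp [Frame.co]
  refine ⟨ΦF.X.repr.symm ((ΦE.X.repr w).mapRange g hg0), ΦE.ext fun s => ?_, fun s hs => ?_⟩
  · rw [C.co_res R, hco, hg _ (h2 s)]
    split_ifs with h
    · rfl
    · push Not at h
      rw [h1 s h]
  · rw [hco, hs, hg0]

theorem forward [CharP F p] [CharP E p] (C : Compat ΦF ΦE N) (hp : p.Prime) (b : F) {n : ℕ}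
    (hker : ∀ w ∈ omegaPow F n, R.res w = 0 → ∃ η ∈ omegaPred F n, w = dForm F b * η)
    (hdesc : ∀ W ∈ omegaPow E n, (∀ s, (∃ i ∈ s, i ∈ N) → ΦE.co W s = 0) →
      (∀ s, ∃ c, algebraMap F E c = ΦE.co W s) →
      ∀ u ∈ omegaPow E n, ∀ v ∈ omegaPred E n, W = ΦE.frob hp u - u + SE.d v →
      ∃ u' ∈ omegaPow E n, ∃ v' ∈ omegaPred E n, W = ΦE.frob hp u' - u' + SE.d v' ∧
        (∀ s, (∃ i ∈ s, i ∈ N) → ΦE.co u' s = 0) ∧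
        (∀ s, ∃ c, algebraMap F E c = ΦE.co u' s) ∧
        (∀ s, (∃ i ∈ s, i ∈ N) → ΦE.co v' s = 0) ∧
        (∀ s, ∃ c, algebraMap F E c = ΦE.co v' s))
    (ω : DF F) (hω : ω ∈ omegaPow F n) (h : R.res ω ∈ hRel SE n) :
    ∃ η ∈ omegaPred F n, ω - dForm F b * η ∈ hRel SF n := by
  classical
  obtain ⟨u, hu, v, hv, e⟩ := (DiffRes.mem_hRel_iff SE).1 h
  obtain ⟨η, hη, e'⟩ := ΦE.sp_frob hp SE hu
  obtain ⟨u', hu', v', hv', e1, a1, a2, a3, a4⟩ := hdesc (R.res ω) (R.res_grade n ω hω)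
    (by
      rintro s ⟨i, hi, hN⟩
      rw [C.co_res R, if_neg]
      exact fun h => h i hi hN)
    (by
      intro s
      rw [C.co_res R]
      split_ifs
      · exact ⟨_, rfl⟩
      · exact ⟨0, map_zero _⟩) u hu (η + v) (Submodule.add_mem _ hη hv) (by
      rw [e, e', map_add]; abel)
  obtain ⟨U, hU, hU'⟩ := C.descend R u' a1 a2
  obtain ⟨V, hV, hV'⟩ := C.descend R v' a3 a4
  have hUm : U ∈ omegaPow F n :=
    ΦF.mem_omegaPow_iff.2 fun s hs => hU' s (ΦE.mem_omegaPow_iff.1 hu' s hs)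
  have hVm : V ∈ omegaPred F n :=
    ΦF.mem_omegaPred_iff.2 fun s hs => hV' s (ΦE.mem_omegaPred_iff.1 hv' s hs)
  obtain ⟨ζ, hζ, e2⟩ := ΦF.sp_frob hp SF hUm
  have hrel : SF.sp U - U + SF.d (V - ζ) ∈ hRel SF n :=
    (DiffRes.mem_hRel_iff SF).2 ⟨U, hUm, _, Submodule.sub_mem _ hVm hζ, rfl⟩
  have e3 : SF.sp U - U + SF.d (V - ζ) = ΦF.frob hp U - U + SF.d V := by
    rw [e2, map_sub]; abel
  have hdm : SF.d V ∈ omegaPow F n := by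
    cases n with
    | zero =>
      have : V = 0 := hVm
      rw [this, map_zero]; exact Submodule.zero_mem _
    | succ n => exact SF.d_grade n V hVm
  have hfm : ΦF.frob hp U ∈ omegaPow F n :=
    ΦF.mem_omegaPow_iff.2 fun s hs => by
      rw [ΦF.co_frob, ΦF.mem_omegaPow_iff.1 hUm s hs, zero_pow hp.ne_zero]
  obtain ⟨θ, hθ, e4⟩ := hker (ω - (ΦF.frob hp U - U + SF.d V))
    (Submodule.sub_mem _ hω (Submodule.add_mem _ (Submodule.sub_mem _ hfm hUm) hdm)) (by
      rw [map_sub, map_add, map_sub, C.res_frob R, R.res_d, hU, hV, e1, sub_self])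
  refine ⟨θ, hθ, ?_⟩
  rw [← e4, sub_sub_cancel, ← e3]
  exact hrel

theorem ker_avoid (C : Compat ΦF ΦE N) (w : DF F) (h : R.res w = 0) (s : Finset ι)
    (hs : ∀ i ∈ s, i ∉ N) : ΦF.co w s = 0 := by
  classical
  have := C.co_res R w s
  rw [h, ΦE.co_zero, if_pos hs] at this
  exact (map_eq_zero _).1 this.symm

theorem ker_main {x : ι} (C : Compat ΦF ΦE {x}) {n : ℕ} (w : DF F) (hw : w ∈ omegaPow F n)
    (h : R.res w = 0) : ∃ η ∈ omegaPred F n, w = dForm F (ΦF.t x) * η := by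
  rw [ΦF.eq_sum w]
  refine Finset.sum_induction _ (fun w => ∃ η ∈ omegaPred F n, w = dForm F (ΦF.t x) * η) ?_ ?_ ?_
  · rintro _ _ ⟨η, hη, rfl⟩ ⟨η', hη', rfl⟩
    exact ⟨η + η', Submodule.add_mem _ hη hη', by rw [mul_add]⟩
  · exact ⟨0, Submodule.zero_mem _, by rw [mul_zero]⟩
  · intro s _
    by_cases hs : x ∈ s ∧ s.card = n
    · obtain ⟨hs, hc⟩ := hs
      refine ⟨(ΦF.co w s * (ΦF.t x)⁻¹) • ΦF.sg x (s.erase x) • ΦF.X (s.erase x), ?_, ?_⟩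
      · have hpos : 0 < s.card := Finset.card_pos.2 ⟨x, hs⟩
        obtain ⟨m, rfl⟩ : ∃ m, n = m + 1 := ⟨n - 1, by omega⟩
        have := ΦF.X_mem (s.erase x)
        rw [Finset.card_erase_of_mem hs, hc] at this
        exact Submodule.smul_mem _ _ (zsmul_mem this _)
      · conv_lhs => rw [X_eq x s hs, ΦF.ell_eq, dLog_eq]
        rw [mul_smul, mul_smul_comm, mul_smul_comm, mul_smul_comm, smul_mul_assoc,
          smul_comm (ΦF.t x)⁻¹]
    · refine ⟨0, Submodule.zero_mem _, ?_⟩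
      have : ΦF.co w s = 0 := by
        by_cases hx : x ∈ s
        · exact ΦF.mem_omegaPow_iff.1 hw s fun hc => hs ⟨hx, hc⟩
        · refine C.ker_avoid R w h s ?_
          rintro i hi rfl
          exact hx hi
      rw [this, zero_smul, mul_zero]

end Compat


theorem forward_dir
    (p : ℕ) (hp : p.Prime) (F E : Type*) [Field F] [Field E] [Algebra F E]
    [CharP F p] [CharP E p]
    (SF : DiffStr p F) (SE : DiffStr p E) (R : DiffRes p F E SF SE)
    (b : F) (β : E) (hβ : β ^ p = algebraMap F E b)
    (hgen : Algebra.adjoin F {β} = ⊤)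
    (n : ℕ) (ω : DF F) (hω : ω ∈ omegaPow F n) (h : R.res ω ∈ hRel SE n) :
    ∃ η ∈ omegaPred F n, ω - dForm F b * η ∈ hRel SF n := by
  by_cases hnot : ∀ c : F, algebraMap F E c ≠ β
  · obtain ⟨ι, _, _, x, ΦF, ΦE, hx, hb, hoff, hD, hD'⟩ := setup_main hp b β hβ hgen hnot
    have C : Compat ΦF ΦE {x} :=
      { off := hoff
        on := by
          rintro i rfl
          rw [hb, ← hβ]
          exact dForm_pow_p β }
    refine C.forward R hp b (fun w hw h => ?_) ?_ ω hω h
    · rw [← hb]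
      exact C.ker_main R w hw h
    · intro W hW h1 h2 u hu v hv e
      obtain ⟨u', hu', v', hv', e', a1, a2, a3, a4⟩ := ΦE.theoremA_graded hp SE x hx W hW
        (fun s hs => h1 s ⟨x, hs, rfl⟩) (fun s => by
          obtain ⟨c, hc⟩ := h2 s
          rw [← hc, hD]) u v e
      refine ⟨u', hu', v', hv', e', ?_, fun s => hD' _ (a2 s), ?_, fun s => hD' _ (a4 s)⟩
      · rintro s ⟨_, hs, rfl⟩
        exact a1 s hs
      · rintro s ⟨_, hs, rfl⟩
        exact a3 s hs
  · push Not at hnot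
    obtain ⟨c, hc⟩ := hnot
    have hsurj : Function.Surjective (algebraMap F E) := by
      intro a
      have ha : a ∈ Algebra.adjoin F {β} := by rw [hgen]; trivial
      have hle : Algebra.adjoin F {β} ≤ ⊥ := by
        rw [Algebra.adjoin_le_iff]
        rintro _ rfl
        exact Algebra.mem_bot.2 ⟨c, hc⟩
      exact Algebra.mem_bot.1 (hle ha)
    obtain ⟨ι, _, ΦF, ΦE, hoff⟩ := setup_trivial (p := p) hp (F := F) (E := E)
      ⟨(algebraMap F E).injective, hsurj⟩
    have C : Compat ΦF ΦE ∅ :=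
      { off := fun i _ => hoff i
        on := by rintro i ⟨⟩ }
    refine C.forward R hp b (fun w hw h => ⟨0, Submodule.zero_mem _, ?_⟩) ?_ ω hω h
    · rw [mul_zero]
      refine ΦF.ext fun s => ?_
      rw [ΦF.co_zero, C.ker_avoid R w h s (fun i _ hi => hi)]
    · intro W hW h1 h2 u hu v hv e
      refine ⟨u, hu, v, hv, e, ?_, fun s => hsurj _, ?_, fun s => hsurj _⟩
      · rintro s ⟨_, _, ⟨⟩⟩
      · rintro s ⟨_, _, ⟨⟩⟩

theorem backward_dir
    (p : ℕ) (F E : Type*) [Field F] [Field E] [Algebra F E]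
    [CharP E p]
    (SF : DiffStr p F) (SE : DiffStr p E) (R : DiffRes p F E SF SE)
    (b : F) (β : E) (hβ : β ^ p = algebraMap F E b)
    (n : ℕ) (ω : DF F)
    (h : ∃ η ∈ omegaPred F n, ω - dForm F b * η ∈ hRel SF n) : R.res ω ∈ hRel SE n := by
  obtain ⟨η, _, h⟩ := h
  have := R.res_hRel h
  rw [map_sub, R.res_mul, R.res_dForm, ← hβ, dForm_pow_p (p := p) β, zero_mul, sub_zero] at this
  exact this

theorem second_form (p : ℕ) (F : Type*) [Field F] (SF : DiffStr p F) (b : F) (n : ℕ) (ω : DF F) :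
    (∃ η ∈ omegaPred F n, ω - dForm F b * η ∈ hRel SF n) ↔
      ∃ η ∈ omegaPred F n, ω - b • SF.d η ∈ hRel SF n := by
  have key : ∀ η ∈ omegaPred F n, dForm F b * η + b • SF.d η ∈ hRel SF n := by
    intro η hη
    rw [← SF.d_smul]
    exact DiffRes.d_mem_hRel SF (Submodule.smul_mem _ b hη)
  constructor
  · rintro ⟨η, hη, h⟩
    refine ⟨-η, Submodule.neg_mem _ hη, ?_⟩
    have := AddSubgroup.add_mem _ h (key η hη)
    rw [map_neg, smul_neg, sub_neg_eq_add]
    convert this using 1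
    abel
  · rintro ⟨η, hη, h⟩
    refine ⟨-η, Submodule.neg_mem _ hη, ?_⟩
    have := AddSubgroup.add_mem _ h (key η hη)
    rw [mul_neg, sub_neg_eq_add]
    convert this using 1
    abel

/-- **Proposition 3.3.** For `b ∈ F` and `E := F(b^{1/p})`, the kernel `H_p^{n+1}(E/F)` equals
the image of `db ∧ Ω_F^{n-1}` in `H_p^{n+1}(F)`, which also equals the image of
`b·d(Ω_F^{n-1})`.  (Stated via membership: the class of `ω ∈ Ω_F^n` dies in `H_p^{n+1}(E)`
iff `ω` is congruent to a form `db ∧ η`, resp. `b·dη`, with `η ∈ Ω_F^{n-1}`,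
modulo `℘Ω_F^n + dΩ_F^{n-1}`.) -/
theorem hKernel_simple_degree_p
    (p : ℕ) (hp : p.Prime) (F E : Type*) [Field F] [Field E] [Algebra F E]
    [CharP F p] [CharP E p]
    (SF : DiffStr p F) (SE : DiffStr p E) (R : DiffRes p F E SF SE)
    (b : F) (β : E) (hβ : β ^ p = algebraMap F E b)
    (hgen : Algebra.adjoin F {β} = ⊤)
    (n : ℕ) (ω : DF F) (hω : ω ∈ omegaPow F n) :
    (R.res ω ∈ hRel SE n ↔ ∃ η ∈ omegaPred F n, ω - dForm F b * η ∈ hRel SF n) ∧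
    (R.res ω ∈ hRel SE n ↔ ∃ η ∈ omegaPred F n, ω - b • SF.d η ∈ hRel SF n) := by
  have h1 : R.res ω ∈ hRel SE n ↔ ∃ η ∈ omegaPred F n, ω - dForm F b * η ∈ hRel SF n :=
    ⟨forward_dir p hp F E SF SE R b β hβ hgen n ω hω, backward_dir p F E SF SE R b β hβ n ω⟩
  exact ⟨h1, h1.trans (second_form p F SF b n ω)⟩
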